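/- Let N ≤ 2 and let B = (β_ij) be a symmetric n×n real matrix, n ≥ 2, with β_ii ≥ 0 for every i. Then the system −Δu_i = ∑_{j=1}^n β_ij u_j² u_i, u₁,…,uₙ ≥ 0 on ℝ^N, admits a nontrivial solution (a tuple of C² nonnegative solutions with at least one component not identically zero) if and only if B is not strictly copositive. -/

import Mathlib

open Finset

/-- The Laplacian of a function `f : ℝ^N → ℝ`: the sum of the second partial
derivatives in the coordinate directions. -/
noncomputable def laplacian {N : ℕ} (f : (Fin N → ℝ) → ℝ) (x : Fin N → ℝ) : ℝ :=
  ∑ i : Fin N, fderiv ℝ (fun y => fderiv ℝ f y (Pi.single i 1)) x (Pi.single i 1)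

section part1
/-! Part 1: kernel space, weak compactness -/

/-- ffold -/
noncomputable def ffold (x : ℝ) : ℝ := Real.arccos (Real.cos (Real.pi * x)) / Real.pi

lemma fold_nonneg (x : ℝ) : 0 ≤ ffold x := by
  unfold ffold; exact div_nonneg (Real.arccos_nonneg _) Real.pi_pos.le

lemma fold_le_one (x : ℝ) : ffold x ≤ 1 := by
  unfold ffold; rw [div_le_one Real.pi_pos]; exact Real.arccos_le_pi _

lemma fold_of_mem {x : ℝ} (h0 : 0 ≤ x) (h1 : x ≤ 1) : ffold x = x := by
  unfold ffold
  have := Real.pi_pos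
  rw [Real.arccos_cos (by positivity) (by nlinarith)]
  field_simp

lemma fold_neg (x : ℝ) : ffold (-x) = ffold x := by
  unfold ffold; rw [mul_neg, Real.cos_neg]

lemma fold_add_two (x : ℝ) : ffold (x + 2) = ffold x := by
  unfold ffold
  rw [show Real.pi * (x + 2) = Real.pi * x + 2 * Real.pi by ring, Real.cos_add_two_pi]

lemma continuous_fold : Continuous ffold := by
  unfold ffold; fun_prop

/-- even 2-periodic functions agreeing on [0,1] are equal -/
lemma eq_of_even_periodic {f g : ℝ → ℝ} (hf : ∀ x, f (-x) = f x) (hf2 : ∀ x, f (x + 2) = f x)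
    (hg : ∀ x, g (-x) = g x) (hg2 : ∀ x, g (x + 2) = g x)
    (h : ∀ x, 0 ≤ x → x ≤ 1 → f x = g x) : f = g := by
  have key : ∀ F : ℝ → ℝ, (∀ x, F (x + 2) = F x) → ∀ x (m : ℤ), F (x - m * 2) = F x := by
    intro F hF x m
    have : Function.Periodic F 2 := hF
    exact this.sub_int_mul_eq m
  funext x
  rw [← key f hf2 x (round (x / 2)), ← key g hg2 x (round (x / 2))]
  have h1 := abs_sub_round (x / 2)
  set y := x - (round (x / 2) : ℤ) * 2 with hy
  have hy1 : |y| ≤ 1 := by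
    rw [show y = 2 * (x / 2 - (round (x / 2) : ℤ)) by rw [hy]; ring, abs_mul]
    norm_num at h1 ⊢
    linarith
  have h2 : ∀ F : ℝ → ℝ, (∀ x, F (-x) = F x) → F y = F |y| := by
    intro F hF
    rcases abs_choice y with h | h <;> rw [h]
    rw [hF]
  rw [h2 f hf, h2 g hg]
  exact h _ (abs_nonneg _) hy1

abbrev HH : Type := MeasureTheory.Lp ℝ 2 (MeasureTheory.volume : MeasureTheory.Measure ℝ)

noncomputable def kk (x : ℝ) : HH :=
  MeasureTheory.indicatorConstLp 2 (measurableSet_Ioc (a := (0:ℝ)) (b := ffold x)) (by simp) (1 : ℝ)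

lemma inner_kk (x y : ℝ) : inner ℝ (kk x) (kk y) = min (ffold x) (ffold y) := by
  unfold kk
  rw [MeasureTheory.L2.real_inner_indicatorConstLp_one_indicatorConstLp_one _ _ (by simp) (by simp)]
  rw [Set.Ioc_inter_Ioc]
  simp [fold_nonneg]

lemma norm_kk_le (x : ℝ) : ‖kk x‖ ≤ 1 := by
  have h := inner_kk x x
  rw [real_inner_self_eq_norm_sq, min_self] at h
  have := fold_le_one x
  nlinarith [norm_nonneg (kk x)]

lemma continuous_kk : Continuous kk := by
  rw [continuous_iff_continuousAt]
  intro x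
  rw [ContinuousAt, tendsto_iff_norm_sub_tendsto_zero]
  have h : ∀ y, ‖kk y - kk x‖ = Real.sqrt (ffold y - 2 * min (ffold y) (ffold x) + ffold x) := by
    intro y
    rw [← Real.sqrt_sq (norm_nonneg (kk y - kk x)), norm_sub_sq_real, inner_kk,
      ← real_inner_self_eq_norm_sq, ← real_inner_self_eq_norm_sq, inner_kk, inner_kk,
      min_self, min_self]
  simp only [h]
  have hc : Continuous fun y => Real.sqrt (ffold y - 2 * min (ffold y) (ffold x) + ffold x) := by
    have := continuous_fold
    fun_prop
  have := hc.tendsto x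
  simpa [show ffold x - 2 * ffold x + ffold x = 0 by ring] using this

lemma kk_neg (x : ℝ) : kk (-x) = kk x := by
  unfold kk; congr 1; rw [fold_neg]
lemma kk_add_two (x : ℝ) : kk (x + 2) = kk x := by
  unfold kk; congr 1; rw [fold_add_two]

instance : SecondCountableTopology HH := by
  have : Fact ((2 : ENNReal) ≠ ⊤) := ⟨by simp⟩
  infer_instance
instance : TopologicalSpace.SeparableSpace HH := inferInstance

open Filter Topology in
lemma weak_compact (f : ℕ → HH) (R : ℝ) (hR : ∀ k, ‖f k‖ ≤ R) :
    ∃ (g : HH) (φ : ℕ → ℕ), StrictMono φ ∧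
      ∀ h : HH, Tendsto (fun k => inner ℝ h (f (φ k))) atTop (𝓝 (inner ℝ h g)) := by
  have := WeakDual.isSeqCompact_closedBall ℝ HH 0 R
  have h2 : ∀ k, (StrongDual.toWeakDual (InnerProductSpace.toDual ℝ HH (f k))) ∈
      (WeakDual.toStrongDual ⁻¹' Metric.closedBall (0 : StrongDual ℝ HH) R) := by
    intro k
    simp [hR k]
  obtain ⟨G, hG, φ, hφ, hlim⟩ := this h2
  refine ⟨(InnerProductSpace.toDual ℝ HH).symm (WeakDual.toStrongDual G), φ, hφ, ?_⟩
  intro h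
  have h3 := (WeakBilin.eval_continuous (topDualPairing ℝ HH) h).continuousAt.tendsto.comp hlim
  rw [real_inner_comm]
  simp only [InnerProductSpace.toDual_symm_apply]
  refine Tendsto.congr ?_ h3
  intro k
  rw [real_inner_comm]
  rfl

end part1

section part2
lemma even_integral {F : ℝ → ℝ} (hF : ∀ x, F (-x) = F x) (x : ℝ) :
    ∫ y in (0:ℝ)..(-x), F y = - ∫ y in (0:ℝ)..x, F y := by
  have := intervalIntegral.integral_comp_neg (a := 0) (b := x) F
  simp only [hF, neg_zero] at this
  rw [this, intervalIntegral.integral_symm]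

lemma odd_integral {F : ℝ → ℝ} (hF : ∀ x, F (-x) = -F x) (x : ℝ) :
    ∫ y in (0:ℝ)..(-x), F y = ∫ y in (0:ℝ)..x, F y := by
  have := intervalIntegral.integral_comp_neg (a := 0) (b := x) F
  simp only [hF, neg_zero, intervalIntegral.integral_neg] at this
  rw [intervalIntegral.integral_symm, ← this, neg_neg]

lemma ode_of_kernel {F u : ℝ → ℝ} {a : ℝ} (hF : Continuous F) (hFe : ∀ x, F (-x) = F x)
    (hFp : ∀ x, F (x + 2) = F x) (hF0 : ∫ y in (0:ℝ)..1, F y = 0)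
    (hu : ∀ x, u x = a + ∫ y in (0:ℝ)..1, F y * min (ffold x) (ffold y)) :
    ∃ u' : ℝ → ℝ, (∀ x, HasDerivAt u (u' x) x) ∧ ∀ x, HasDerivAt u' (-F x) x := by
  set D : ℝ → ℝ := fun x => -∫ y in (0:ℝ)..x, F y with hD
  set V : ℝ → ℝ := fun x => a + (∫ y in (0:ℝ)..x, F y * y) - x * ∫ y in (0:ℝ)..x, F y with hV
  have hdF : ∀ x, HasDerivAt (fun x => ∫ y in (0:ℝ)..x, F y) (F x) x := fun x =>
    hF.integral_hasStrictDerivAt 0 x |>.hasDerivAt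
  have hFy : Continuous fun y => F y * y := by fun_prop
  have hdFy : ∀ x, HasDerivAt (fun x => ∫ y in (0:ℝ)..x, F y * y) (F x * x) x := fun x =>
    hFy.integral_hasStrictDerivAt 0 x |>.hasDerivAt
  have hDd : ∀ x, HasDerivAt D (-F x) x := fun x => (hdF x).neg
  have hVd : ∀ x, HasDerivAt V (D x) x := by
    intro x
    have := ((hdFy x).const_add a).sub ((hasDerivAt_id x).mul (hdF x))
    refine this.congr_deriv ?_
    simp only [hD, id]
    ring
  have hVe : ∀ x, V (-x) = V x := by
    intro x
    simp only [hV]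
    rw [even_integral hFe, odd_integral (F := fun y => F y * y) (by intro x; simp [hFe])]
    ring
  have hD2 : ∀ x, D (x + 2) = D x := by
    intro x
    have hper : Function.Periodic F 2 := hFp
    have h1 := hper.intervalIntegral_add_eq x (-1)
    have hi : ∀ a b, IntervalIntegrable F MeasureTheory.volume a b := fun a b =>
      hF.intervalIntegrable a b
    have h2 : ∫ y in (-1:ℝ)..(-1 + 2), F y = 0 := by
      rw [← intervalIntegral.integral_add_adjacent_intervals (hi (-1) 0) (hi 0 (-1+2)),
        intervalIntegral.integral_symm, even_integral hFe]
      norm_num [hF0]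
    rw [h2] at h1
    have h3 := intervalIntegral.integral_add_adjacent_intervals (hi 0 x) (hi x (x + 2))
    simp only [hD]
    rw [← h3, h1]; ring
  have hV2 : ∀ x, V (x + 2) = V x := by
    have hc : ∀ x, HasDerivAt (fun x => V (x + 2) - V x) 0 x := by
      intro x
      have := ((hVd (x + 2)).comp_add_const x 2).sub (hVd x)
      rwa [hD2, sub_self] at this
    intro x
    have h1 := is_const_of_deriv_eq_zero (f := fun x => V (x + 2) - V x)
      (fun x => (hc x).differentiableAt) (fun x => (hc x).deriv) x (-1)
    have h2 := hVe 1
    norm_num at h1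
    linarith
  have huV : u = V := by
    apply eq_of_even_periodic _ _ hVe hV2
    · intro x h0 h1
      have hi : ∀ a b, IntervalIntegrable (fun y => F y * min (ffold x) (ffold y))
          MeasureTheory.volume a b := fun a b => by
        have := continuous_fold
        apply Continuous.intervalIntegrable; fun_prop
      rw [hu, ← intervalIntegral.integral_add_adjacent_intervals (hi 0 x) (hi x 1)]
      have e1 : ∫ y in (0:ℝ)..x, F y * min (ffold x) (ffold y) = ∫ y in (0:ℝ)..x, F y * y := by
        apply intervalIntegral.integral_congr
        intro y hy
        rw [Set.uIcc_of_le h0] at hy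
        simp only
        rw [fold_of_mem h0 h1, fold_of_mem hy.1 (hy.2.trans h1), min_eq_right hy.2]
      have e2 : ∫ y in x..1, F y * min (ffold x) (ffold y) = ∫ y in x..1, F y * x := by
        apply intervalIntegral.integral_congr
        intro y hy
        rw [Set.uIcc_of_le h1] at hy
        simp only
        rw [fold_of_mem h0 h1, fold_of_mem (h0.trans hy.1) hy.2, min_eq_left hy.1]
      have e3 := intervalIntegral.integral_add_adjacent_intervals
        (hF.intervalIntegrable (μ := MeasureTheory.volume) 0 x) (hF.intervalIntegrable x 1)
      rw [e1, e2, intervalIntegral.integral_mul_const]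
      simp only [hV]
      rw [hF0] at e3
      have : ∫ y in x..1, F y = - ∫ y in (0:ℝ)..x, F y := by linarith
      rw [this]; ring
    · intro x; rw [hu, hu, fold_neg]
    · intro x; rw [hu, hu, fold_add_two]
  refine ⟨D, ?_, hDd⟩
  rw [huV]; exact hVd

lemma nonneg_of_ode {u u' G : ℝ → ℝ} (hu : ∀ x, HasDerivAt u (u' x) x)
    (hu' : ∀ x, HasDerivAt u' (-(G x * max (u x) 0)) x) (hf : ∀ x, u x = u (ffold x))
    (hp : ∃ x, 0 < u x) : ∀ x, 0 ≤ u x := by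
  have hcont : Continuous u := continuous_iff_continuousAt.2 fun x => (hu x).continuousAt
  obtain ⟨x0, hx0, hmin⟩ := (isCompact_Icc (a := (0:ℝ)) (b := 1)).exists_isMinOn
    (Set.nonempty_Icc.2 zero_le_one) hcont.continuousOn
  have hmin' : ∀ x, u x0 ≤ u x := by
    intro x
    rw [hf x]
    exact hmin ⟨fold_nonneg x, fold_le_one x⟩
  by_contra! hneg
  obtain ⟨z, hz⟩ := hneg
  have hm : u x0 < 0 := (hmin' z).trans_lt hz
  have hclopen : IsClopen {x | u x = u x0} := by
    refine ⟨isClosed_eq hcont continuous_const, ?_⟩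
    rw [Metric.isOpen_iff]
    intro x hx
    simp only [Set.mem_ofPred_eq] at hx
    have hopen : IsOpen {y | u y < 0} := isOpen_lt hcont continuous_const
    obtain ⟨ε, hε, hb⟩ := Metric.isOpen_iff.1 hopen x (by simp [hx, hm])
    refine ⟨ε, hε, ?_⟩
    have hd0 : u' x = 0 := by
      have : IsLocalMin u x := Filter.Eventually.of_forall fun y => by rw [hx]; exact hmin' y
      exact this.hasDerivAt_eq_zero (hu x)
    have h1 : ∀ y ∈ Metric.ball x ε, u' y = 0 := by
      intro y hy
      rw [← hd0]
      refine (convex_ball x ε).is_const_of_fderivWithin_eq_zero (𝕜 := ℝ) (f := u') ?_ ?_ hy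
        (Metric.mem_ball_self hε)
      · exact fun t _ => (hu' t).differentiableAt.differentiableWithinAt
      · intro t ht
        have hut : u t < 0 := hb ht
        have h2 := (hu' t)
        rw [max_eq_right hut.le, mul_zero, neg_zero] at h2
        have h3 := h2.hasFDerivAt.hasFDerivWithinAt (s := Metric.ball x ε)
        rw [h3.fderivWithin (Metric.isOpen_ball.uniqueDiffWithinAt ht)]
        ext; simp
    intro y hy
    simp only [Set.mem_ofPred_eq]
    rw [← hx]
    refine (convex_ball x ε).is_const_of_fderivWithin_eq_zero (𝕜 := ℝ) (f := u) ?_ ?_ hy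
        (Metric.mem_ball_self hε)
    · exact fun t _ => (hu t).differentiableAt.differentiableWithinAt
    · intro t ht
      have h2 := (hu t)
      rw [h1 t ht] at h2
      have h3 := h2.hasFDerivAt.hasFDerivWithinAt (s := Metric.ball x ε)
      rw [h3.fderivWithin (Metric.isOpen_ball.uniqueDiffWithinAt ht)]
      ext; simp
  obtain ⟨y, hy⟩ := hp
  have := hclopen.eq_univ ⟨x0, rfl⟩
  have hy2 : y ∈ {x | u x = u x0} := by rw [this]; trivial
  simp only [Set.mem_ofPred_eq] at hy2
  linarith

end part2

section part3
section matrix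
variable {ι : Type*} [Fintype ι]

/-- quadratic form -/
def qf (B : ι → ι → ℝ) (v : ι → ℝ) : ℝ := ∑ i, ∑ j, B i j * v i * v j

lemma qf_add_smul (B : ι → ι → ℝ) (hB : ∀ i j, B i j = B j i) (c v : ι → ℝ) (t : ℝ) :
    qf B (c + t • v) = qf B c + 2 * t * (∑ i, ∑ j, B i j * c i * v j) + t ^ 2 * qf B v := by
  have h : ∑ i, ∑ j, B i j * v i * c j = ∑ i, ∑ j, B i j * c i * v j := by
    rw [Finset.sum_comm]
    refine Finset.sum_congr rfl fun i _ => Finset.sum_congr rfl fun j _ => ?_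
    rw [hB]; ring
  have : qf B (c + t • v) = qf B c + t * (∑ i, ∑ j, B i j * c i * v j)
      + t * (∑ i, ∑ j, B i j * v i * c j) + t ^ 2 * qf B v := by
    simp only [qf, Finset.mul_sum, ← Finset.sum_add_distrib]
    refine Finset.sum_congr rfl fun i _ => Finset.sum_congr rfl fun j _ => ?_
    simp only [Pi.add_apply, Pi.smul_apply, smul_eq_mul]
    ring
  rw [this, h]; ring

lemma qf_smul (B : ι → ι → ℝ) (v : ι → ℝ) (t : ℝ) : qf B (t • v) = t ^ 2 * qf B v := by
  simp only [qf, Finset.mul_sum]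
  refine Finset.sum_congr rfl fun i _ => Finset.sum_congr rfl fun j _ => ?_
  simp only [Pi.smul_apply, smul_eq_mul]
  ring

lemma qf_neg (B : ι → ι → ℝ) (v : ι → ℝ) : qf B (-v) = qf B v := by
  simp [qf]

lemma qf_mixed_pos (B : ι → ι → ℝ) (hB : ∀ i j, B i j = B j i) (c : ι → ℝ) (hc : ∀ i, 0 ≤ c i)
    (hqc : qf B c < 0)
    (H2 : ∀ d : ι → ℝ, (∀ i, 0 ≤ d i) → d ≠ 0 → (∃ i, d i = 0) → 0 < qf B d)
    (v : ι → ℝ) (hv : v ≠ 0) (h1 : ∃ i, v i ≤ 0) (h2 : ∃ i, 0 ≤ v i) : 0 < qf B v := by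
  have hc0 : c ≠ 0 := by rintro rfl; simp [qf] at hqc
  have hcpos : ∀ i, 0 < c i := by
    intro i
    rcases (hc i).lt_or_eq with h | h
    · exact h
    · exact absurd (H2 c hc hc0 ⟨i, h.symm⟩) (not_lt.2 hqc.le)
  have main : ∀ v : ι → ℝ, v ≠ 0 → (∃ i, v i ≤ 0) → (∑ i, ∑ j, B i j * c i * v j) ≤ 0 →
      0 < qf B v := by
    intro v hv h1 hb
    by_contra! hq
    by_cases hneg : ∃ j, v j < 0
    · obtain ⟨j, hj⟩ := hneg
      obtain ⟨j0, hj0, hmin⟩ := Finset.exists_min_image (Finset.univ.filter fun j => v j < 0)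
        (fun j => c j / (-v j)) ⟨j, by simp [hj]⟩
      simp only [Finset.mem_filter, Finset.mem_univ, true_and] at hj0 hmin
      set t := c j0 / (-v j0) with ht
      have htpos : 0 < t := div_pos (hcpos _) (by linarith)
      have hqd : qf B (c + t • v) < 0 := by
        rw [qf_add_smul B hB]
        have : t ^ 2 * qf B v ≤ 0 := mul_nonpos_of_nonneg_of_nonpos (by positivity) hq
        have : 2 * t * (∑ i, ∑ j, B i j * c i * v j) ≤ 0 :=
          mul_nonpos_of_nonneg_of_nonpos (by positivity) hb
        linarith
      have hd : ∀ i, 0 ≤ (c + t • v) i := by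
        intro i
        simp only [Pi.add_apply, Pi.smul_apply, smul_eq_mul]
        by_cases hi : v i < 0
        · have := hmin i hi
          rw [le_div_iff₀ (by linarith)] at this
          linarith
        · have := mul_nonneg htpos.le (not_lt.1 hi)
          linarith [hc i]
      have hz : (c + t • v) j0 = 0 := by
        simp only [Pi.add_apply, Pi.smul_apply, smul_eq_mul, ht]
        have : v j0 ≠ 0 := hj0.ne
        field_simp; ring
      have := H2 _ hd (by intro h; rw [h] at hqd; simp [qf] at hqd) ⟨j0, hz⟩
      linarith
    · push Not at hneg
      obtain ⟨i, hi⟩ := h1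
      have := H2 v hneg hv ⟨i, le_antisymm hi (hneg i)⟩
      linarith
  rcases le_total (∑ i, ∑ j, B i j * c i * v j) 0 with h | h
  · exact main v hv h1 h
  · rw [← qf_neg]
    refine main (-v) (by simpa using hv) ?_ ?_
    · obtain ⟨i, hi⟩ := h2; exact ⟨i, by simpa using hi⟩
    · simp only [Pi.neg_apply, mul_neg, Finset.sum_neg_distrib]; linarith

/-- psi -/
noncomputable def psi (g : ι → ℝ) (m : ι → ι → ℝ) (s : ι → ℝ) : ℝ :=
  (∑ i, g i * s i) / 2 - qf m s / 4

open Filter Topology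

lemma tendsto_qf {m : ℕ → ι → ι → ℝ} {m0 : ι → ι → ℝ} {s : ℕ → ι → ℝ} {s0 : ι → ℝ}
    (hm : Tendsto m atTop (𝓝 m0)) (hs : Tendsto s atTop (𝓝 s0)) :
    Tendsto (fun k => qf (m k) (s k)) atTop (𝓝 (qf m0 s0)) := by
  unfold qf
  refine tendsto_finsetSum _ fun i _ => tendsto_finsetSum _ fun j _ => ?_
  exact (((tendsto_pi_nhds.1 ((tendsto_pi_nhds.1 hm) i)) j).mul ((tendsto_pi_nhds.1 hs) i)).mul
    ((tendsto_pi_nhds.1 hs) j)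

lemma tendsto_lin {g : ℕ → ι → ℝ} {g0 : ι → ℝ} {s : ℕ → ι → ℝ} {s0 : ι → ℝ}
    (hg : Tendsto g atTop (𝓝 g0)) (hs : Tendsto s atTop (𝓝 s0)) :
    Tendsto (fun k => ∑ i, g k i * s k i) atTop (𝓝 (∑ i, g0 i * s0 i)) := by
  refine tendsto_finsetSum _ fun i _ => ?_
  exact ((tendsto_pi_nhds.1 hg) i).mul ((tendsto_pi_nhds.1 hs) i)

lemma tendsto_psi {g : ℕ → ι → ℝ} {g0 : ι → ℝ} {m : ℕ → ι → ι → ℝ} {m0 : ι → ι → ℝ}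
    {s : ℕ → ι → ℝ} {s0 : ι → ℝ} (hg : Tendsto g atTop (𝓝 g0))
    (hm : Tendsto m atTop (𝓝 m0)) (hs : Tendsto s atTop (𝓝 s0)) :
    Tendsto (fun k => psi (g k) (m k) (s k)) atTop (𝓝 (psi g0 m0 s0)) :=
  ((tendsto_lin hg hs).div_const 2).sub ((tendsto_qf hm hs).div_const 4)

/-- bounded maximizing sequences -/
lemma psi_bounded (g : ℕ → ι → ℝ) (m : ℕ → ι → ι → ℝ) (g0 : ι → ℝ) (m0 : ι → ι → ℝ)
    (hg : Tendsto g atTop (𝓝 g0)) (hm : Tendsto m atTop (𝓝 m0))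
    (hpd : ∀ v : ι → ℝ, v ≠ 0 → 0 < qf m0 v) (s : ℕ → ι → ℝ) (C : ℝ)
    (hs : ∀ k, C ≤ psi (g k) (m k) (s k)) :
    ∃ (s0 : ι → ℝ) (φ : ℕ → ℕ), StrictMono φ ∧ Tendsto (fun k => s (φ k)) atTop (𝓝 s0) := by
  -- lower bound on sphere
  by_cases hb : ∃ R, ∃ᶠ k in atTop, ‖s k‖ ≤ R
  · obtain ⟨R, hR⟩ := hb
    obtain ⟨s0, _, φ, hφ, hl⟩ := (isCompact_closedBall (0 : ι → ℝ) R).isSeqCompact.subseq_of_frequently_in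
      (x := s) (by simpa using hR)
    exact ⟨s0, φ, hφ, hl⟩
  · exfalso
    push Not at hb
    have hinf : Tendsto (fun k => ‖s k‖) atTop atTop := by
      rw [tendsto_atTop]
      intro R
      filter_upwards [hb R] with k hk using hk.le
    set v : ℕ → ι → ℝ := fun k => (‖s k‖)⁻¹ • s k with hv
    have hvn : ∀ k, ‖v k‖ ≤ 1 := by
      intro k
      rw [hv]; simp only [norm_smul, norm_inv, norm_norm]
      exact inv_mul_le_one
    obtain ⟨v0, hv0, φ, hφ, hl⟩ := (isCompact_closedBall (0 : ι → ℝ) 1).isSeqCompact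
      (x := v) (by intro k; simpa using hvn k)
    have hpos : ∀ᶠ k in atTop, 0 < ‖s k‖ := hinf.eventually_gt_atTop 0
    have hinf' := hinf.comp hφ.tendsto_atTop
    have hv0n : ‖v0‖ = 1 := by
      refine tendsto_nhds_unique (hl.norm) ?_
      refine tendsto_const_nhds.congr' ?_
      filter_upwards [hφ.tendsto_atTop.eventually hpos] with k hk
      simp only [hv, Function.comp, norm_smul, norm_inv, norm_norm]
      field_simp
    have hv0ne : v0 ≠ 0 := by intro h; rw [h] at hv0n; simp at hv0n
    have hq : Tendsto (fun k => qf (m (φ k)) (v (φ k))) atTop (𝓝 (qf m0 v0)) :=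
      tendsto_qf (hm.comp hφ.tendsto_atTop) hl
    have hL : Tendsto (fun k => ∑ i, g (φ k) i * v (φ k) i) atTop (𝓝 (∑ i, g0 i * v0 i)) :=
      tendsto_lin (hg.comp hφ.tendsto_atTop) hl
    -- C / ‖s‖^2 ≤ L/(2‖s‖) - q/4
    have hinv : Tendsto (fun k => (‖s (φ k)‖)⁻¹) atTop (𝓝 0) := tendsto_inv_atTop_zero.comp hinf'
    have hlhs : Tendsto (fun k => C * ((‖s (φ k)‖)⁻¹ * (‖s (φ k)‖)⁻¹)) atTop (𝓝 (C * (0 * 0))) :=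
      (hinv.mul hinv).const_mul C
    have hrhs := ((hL.mul hinv).div_const 2).sub (hq.div_const 4)
    have hle := le_of_tendsto_of_tendsto hlhs hrhs (by
      filter_upwards [hφ.tendsto_atTop.eventually hpos] with k hk
      have h1 := hs (φ k)
      have hsv : s (φ k) = ‖s (φ k)‖ • v (φ k) := by
        simp only [hv, smul_smul]
        rw [mul_inv_cancel₀ hk.ne', one_smul]
      have h2 : psi (g (φ k)) (m (φ k)) (s (φ k)) =
          ‖s (φ k)‖ * (∑ i, g (φ k) i * v (φ k) i) / 2
          - ‖s (φ k)‖ ^ 2 * qf (m (φ k)) (v (φ k)) / 4 := by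
        unfold psi
        conv_lhs => rw [hsv]
        rw [qf_smul, Finset.mul_sum]
        congr 2
        refine Finset.sum_congr rfl fun i _ => ?_
        simp only [Pi.smul_apply, smul_eq_mul]; ring
      rw [h2] at h1
      set r := ‖s (φ k)‖
      have h3 : (r⁻¹ * r⁻¹) * C ≤ (r⁻¹ * r⁻¹) * (r * (∑ i, g (φ k) i * v (φ k) i) / 2
          - r ^ 2 * qf (m (φ k)) (v (φ k)) / 4) := by
        apply mul_le_mul_of_nonneg_left h1; positivity
      calc C * (r⁻¹ * r⁻¹) = (r⁻¹ * r⁻¹) * C := by ring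
        _ ≤ _ := h3
        _ = _ := by field_simp)
    have := hpd v0 hv0ne
    norm_num at hle
    linarith

lemma psi_unique (g0 : ι → ℝ) (m0 : ι → ι → ℝ) (hpd : ∀ v : ι → ℝ, v ≠ 0 → 0 < qf m0 v) (c : ℝ)
    (hle : ∀ s : ι → ℝ, (∀ i, 0 ≤ s i) → psi g0 m0 s ≤ c) (s t : ι → ℝ) (hs : ∀ i, 0 ≤ s i)
    (ht : ∀ i, 0 ≤ t i) (hsc : c ≤ psi g0 m0 s) (htc : c ≤ psi g0 m0 t) : s = t := by
  by_contra hne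
  have h1 := hpd (s - t) (sub_ne_zero.2 hne)
  have h2 := hle ((1/2 : ℝ) • (s + t)) (fun i => by
    simp only [Pi.smul_apply, Pi.add_apply, smul_eq_mul]; linarith [hs i, ht i])
  have h3 : psi g0 m0 ((1/2 : ℝ) • (s + t)) = (psi g0 m0 s + psi g0 m0 t) / 2
      + qf m0 (s - t) / 16 := by
    have a1 : ∑ i, g0 i * ((1/2 : ℝ) • (s + t)) i
        = ((∑ i, g0 i * s i) + ∑ i, g0 i * t i) / 2 := by
      rw [← Finset.sum_add_distrib, Finset.sum_div]
      refine Finset.sum_congr rfl fun i _ => ?_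
      simp only [Pi.smul_apply, Pi.add_apply, smul_eq_mul]; ring
    have a2 : qf m0 (s - t) + 4 * qf m0 ((1/2 : ℝ) • (s + t)) = 2 * qf m0 s + 2 * qf m0 t := by
      simp only [qf, Finset.mul_sum, ← Finset.sum_add_distrib]
      refine Finset.sum_congr rfl fun i _ => Finset.sum_congr rfl fun j _ => ?_
      simp only [Pi.smul_apply, Pi.add_apply, Pi.sub_apply, smul_eq_mul]; ring
    unfold psi
    rw [a1]; linarith
  linarith

lemma envelope_half (g : ℝ → ι → ℝ) (m : ℝ → ι → ι → ℝ) (g' : ι → ℝ) (m' : ι → ι → ℝ)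
    (hg : ∀ i, HasDerivAt (fun e => g e i) (g' i) 0)
    (hm : ∀ i j, HasDerivAt (fun e => m e i j) (m' i j) 0)
    (hpd : ∀ v : ι → ℝ, v ≠ 0 → 0 < qf (m 0) v) (c : ℝ)
    (hle : ∀ s : ι → ℝ, (∀ i, 0 ≤ s i) → psi (g 0) (m 0) s ≤ c)
    (hge : ∀ᶠ e in 𝓝 (0:ℝ), ∀ η > 0, ∃ s : ι → ℝ, (∀ i, 0 ≤ s i) ∧ c - η < psi (g e) (m e) s)
    (t : ι → ℝ) (ht : ∀ i, 0 ≤ t i) (htc : psi (g 0) (m 0) t = c) :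
    0 ≤ psi g' m' t := by
  obtain ⟨e, he, he2⟩ : ∃ e : ℕ → ℝ, (∀ k, 0 < e k) ∧ Tendsto e atTop (𝓝 0) :=
    ⟨fun k => 1 / ((k:ℝ) + 1), fun k => by positivity, tendsto_one_div_add_atTop_nhds_zero_nat⟩
  obtain ⟨K, hK⟩ := (he2.eventually hge).exists_forall_of_atTop
  have hch : ∀ k, ∃ s : ι → ℝ, (∀ i, 0 ≤ s i) ∧
      c - e (k + K) ^ 2 < psi (g (e (k + K))) (m (e (k + K))) s := fun k =>
    hK (k + K) (by omega) _ (pow_pos (he _) 2)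
  choose s hs0 hs1 using hch
  set ε : ℕ → ℝ := fun k => e (k + K) with hε
  have hεpos : ∀ k, 0 < ε k := fun k => he _
  have hεl : Tendsto ε atTop (𝓝 0) := he2.comp (tendsto_add_atTop_nat K)
  have hgc : Tendsto (fun k => g (ε k)) atTop (𝓝 (g 0)) := by
    rw [tendsto_pi_nhds]; intro i
    exact (hg i).continuousAt.tendsto.comp hεl
  have hmc : Tendsto (fun k => m (ε k)) atTop (𝓝 (m 0)) := by
    rw [tendsto_pi_nhds]; intro i; rw [tendsto_pi_nhds]; intro j
    exact (hm i j).continuousAt.tendsto.comp hεl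
  obtain ⟨R, hR⟩ := (hεl.pow 2).bddAbove_range
  obtain ⟨s0, φ, hφ, hl⟩ := psi_bounded _ _ _ _ hgc hmc hpd s (c - R) (fun k => by
    have := hR ⟨k, rfl⟩
    have := hs1 k
    simp only [hε] at *
    linarith)
  have hφt := hφ.tendsto_atTop
  have hs00 : ∀ i, 0 ≤ s0 i := fun i =>
    ge_of_tendsto' ((tendsto_pi_nhds.1 hl) i) fun k => hs0 _ i
  have hc0 : c ≤ psi (g 0) (m 0) s0 := by
    have h1 : Tendsto (fun k => psi (g (ε (φ k))) (m (ε (φ k))) (s (φ k))) atTop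
        (𝓝 (psi (g 0) (m 0) s0)) :=
      tendsto_psi (hgc.comp hφt) (hmc.comp hφt) hl
    have h2 : Tendsto (fun k => c - ε (φ k) ^ 2) atTop (𝓝 (c - 0 ^ 2)) :=
      ((hεl.comp hφt).pow 2).const_sub c
    have := le_of_tendsto_of_tendsto' h2 h1 fun k => (hs1 (φ k)).le
    simpa using this
  have hst : s0 = t := psi_unique _ _ hpd c hle s0 t hs00 ht hc0 htc.ge
  rw [← hst]
  have hεne : Tendsto (fun k => ε (φ k)) atTop (𝓝[≠] 0) := by
    rw [tendsto_nhdsWithin_iff]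
    exact ⟨hεl.comp hφt, Eventually.of_forall fun k => (hεpos _).ne'⟩
  have hgd : Tendsto (fun k => (fun i => (ε (φ k))⁻¹ * (g (ε (φ k)) i - g 0 i))) atTop (𝓝 g') := by
    rw [tendsto_pi_nhds]; intro i
    have := (hg i).tendsto_slope_zero.comp hεne
    simpa [Function.comp_def] using this
  have hmd : Tendsto (fun k => (fun i j => (ε (φ k))⁻¹ * (m (ε (φ k)) i j - m 0 i j))) atTop
      (𝓝 m') := by
    rw [tendsto_pi_nhds]; intro i; rw [tendsto_pi_nhds]; intro j
    have := (hm i j).tendsto_slope_zero.comp hεne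
    simpa [Function.comp_def] using this
  have h1 := tendsto_psi hgd hmd hl
  have h2 : Tendsto (fun k => - ε (φ k)) atTop (𝓝 (-0)) := (hεl.comp hφt).neg
  have := le_of_tendsto_of_tendsto' h2 h1 fun k => by
    have a1 := hs1 (φ k)
    have a2 := hle (s (φ k)) (hs0 _)
    have a3 : psi (fun i => (ε (φ k))⁻¹ * (g (ε (φ k)) i - g 0 i))
        (fun i j => (ε (φ k))⁻¹ * (m (ε (φ k)) i j - m 0 i j)) (s (φ k)) =
        (ε (φ k))⁻¹ * (psi (g (ε (φ k))) (m (ε (φ k))) (s (φ k)) - psi (g 0) (m 0) (s (φ k))) := by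
      have b1 : ∑ i, (ε (φ k))⁻¹ * (g (ε (φ k)) i - g 0 i) * s (φ k) i =
         (ε (φ k))⁻¹ * (∑ i, g (ε (φ k)) i * s (φ k) i - ∑ i, g 0 i * s (φ k) i) := by
        rw [← Finset.sum_sub_distrib, Finset.mul_sum]
        exact Finset.sum_congr rfl fun i _ => by ring
      have b2 : qf (fun i j => (ε (φ k))⁻¹ * (m (ε (φ k)) i j - m 0 i j)) (s (φ k)) =
         (ε (φ k))⁻¹ * (qf (m (ε (φ k))) (s (φ k)) - qf (m 0) (s (φ k))) := by
        simp only [qf]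
        rw [← Finset.sum_sub_distrib, Finset.mul_sum]
        refine Finset.sum_congr rfl fun i _ => ?_
        rw [← Finset.sum_sub_distrib, Finset.mul_sum]
        exact Finset.sum_congr rfl fun j _ => by ring
      unfold psi
      rw [b1, b2]; ring
    rw [a3]
    have hp := hεpos (φ k)
    have a4 : -(ε (φ k)) ^ 2 ≤ psi (g (ε (φ k))) (m (ε (φ k))) (s (φ k)) - psi (g 0) (m 0) (s (φ k)) := by
      simp only [hε] at *; linarith
    rw [inv_mul_eq_div, le_div_iff₀ hp]
    linarith
  simpa using this

lemma envelope (g : ℝ → ι → ℝ) (m : ℝ → ι → ι → ℝ) (g' : ι → ℝ) (m' : ι → ι → ℝ)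
    (hg : ∀ i, HasDerivAt (fun e => g e i) (g' i) 0)
    (hm : ∀ i j, HasDerivAt (fun e => m e i j) (m' i j) 0)
    (hpd : ∀ v : ι → ℝ, v ≠ 0 → 0 < qf (m 0) v) (c : ℝ)
    (hle : ∀ s : ι → ℝ, (∀ i, 0 ≤ s i) → psi (g 0) (m 0) s ≤ c)
    (hge : ∀ᶠ e in 𝓝 (0:ℝ), ∀ η > 0, ∃ s : ι → ℝ, (∀ i, 0 ≤ s i) ∧ c - η < psi (g e) (m e) s)
    (t : ι → ℝ) (ht : ∀ i, 0 ≤ t i) (htc : psi (g 0) (m 0) t = c) :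
    psi g' m' t = 0 := by
  apply le_antisymm _ (envelope_half g m g' m' hg hm hpd c hle hge t ht htc)
  have hneg : Tendsto (fun e : ℝ => -e) (𝓝 0) (𝓝 0) := by
    simpa using (continuous_neg (G := ℝ)).tendsto 0
  have := envelope_half (fun e => g (-e)) (fun e => m (-e)) (fun i => -g' i) (fun i j => - m' i j)
    (fun i => by
      have := HasDerivAt.scomp (0:ℝ) (h := fun e : ℝ => -e) (g₁ := fun e => g e i) (g₁' := g' i)
        (by simpa using hg i) (hasDerivAt_neg (0:ℝ))
      simpa [Function.comp_def] using this)
    (fun i j => by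
      have := HasDerivAt.scomp (0:ℝ) (h := fun e : ℝ => -e) (g₁ := fun e => m e i j)
        (g₁' := m' i j) (by simpa using hm i j) (hasDerivAt_neg (0:ℝ))
      simpa [Function.comp_def] using this)
    (by simpa using hpd) c (by simpa using hle) (hneg.eventually hge) t ht (by simpa using htc)
  have h2 : psi (fun i => -g' i) (fun i j => - m' i j) t = - psi g' m' t := by
    simp only [psi, qf, neg_mul, Finset.sum_neg_distrib]; ring
  linarith

lemma exists_max (g : ι → ℝ) (m : ι → ι → ℝ)
    (hpd : ∀ v : ι → ℝ, v ≠ 0 → 0 < qf m v) (c : ℝ)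
    (hle : ∀ s : ι → ℝ, (∀ i, 0 ≤ s i) → psi g m s ≤ c)
    (hge : ∀ η > 0, ∃ s : ι → ℝ, (∀ i, 0 ≤ s i) ∧ c - η < psi g m s) :
    ∃ t : ι → ℝ, (∀ i, 0 ≤ t i) ∧ psi g m t = c := by
  have h : ∀ k : ℕ, ∃ s : ι → ℝ, (∀ i, 0 ≤ s i) ∧ c - 1 / ((k:ℝ) + 1) < psi g m s := fun k =>
    hge _ (by positivity)
  choose s hs0 hs1 using h
  obtain ⟨s0, φ, hφ, hl⟩ := psi_bounded (fun _ => g) (fun _ => m) g m tendsto_const_nhds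
    tendsto_const_nhds hpd s (c - 1) (fun k => by
      have h1 : 1 / ((k:ℝ) + 1) ≤ 1 := by
        rw [div_le_one (by positivity)]; linarith [(Nat.cast_nonneg k : (0:ℝ) ≤ k)]
      linarith [hs1 k])
  have hs00 : ∀ i, 0 ≤ s0 i := fun i =>
    ge_of_tendsto' ((tendsto_pi_nhds.1 hl) i) fun k => hs0 _ i
  refine ⟨s0, hs00, le_antisymm (hle _ hs00) ?_⟩
  have h1 : Tendsto (fun k => psi g m (s (φ k))) atTop (𝓝 (psi g m s0)) :=
      tendsto_psi tendsto_const_nhds tendsto_const_nhds hl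
  have h2 : Tendsto (fun k => c - 1 / (((φ k : ℕ) : ℝ) + 1)) atTop (𝓝 (c - 0)) :=
      (tendsto_one_div_add_atTop_nhds_zero_nat.comp hφ.tendsto_atTop).const_sub c
  have := le_of_tendsto_of_tendsto' h2 h1 fun k => (hs1 (φ k)).le
  simpa using this
end matrix

end part3

section part4
open Filter Topology

noncomputable def ev (p : ℝ × HH) (x : ℝ) : ℝ := p.1 + inner ℝ (kk x) p.2
noncomputable def pev (p : ℝ × HH) (x : ℝ) : ℝ := max (ev p x) 0
noncomputable def wev (p : ℝ × HH) (x : ℝ) : ℝ := pev p x ^ 2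
noncomputable def II (p q : ℝ × HH) : ℝ := ∫ x in (0:ℝ)..1, wev p x * wev q x

lemma continuous_ev (p : ℝ × HH) : Continuous (ev p) := by
  unfold ev
  have := continuous_kk
  fun_prop
lemma continuous_pev (p : ℝ × HH) : Continuous (pev p) :=
  (continuous_ev p).max continuous_const
lemma continuous_wev (p : ℝ × HH) : Continuous (wev p) := (continuous_pev p).pow 2
lemma pev_nonneg (p : ℝ × HH) (x : ℝ) : 0 ≤ pev p x := le_max_right _ _
lemma wev_nonneg (p : ℝ × HH) (x : ℝ) : 0 ≤ wev p x := sq_nonneg _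

lemma ev_fold (p : ℝ × HH) (x : ℝ) : ev p (ffold x) = ev p x := by
  unfold ev
  have : kk (ffold x) = kk x := by
    unfold kk; congr 1; rw [fold_of_mem (fold_nonneg _) (fold_le_one _)]
  rw [this]

lemma ev_neg (p : ℝ × HH) (x : ℝ) : ev p (-x) = ev p x := by unfold ev; rw [kk_neg]
lemma ev_add_two (p : ℝ × HH) (x : ℝ) : ev p (x + 2) = ev p x := by unfold ev; rw [kk_add_two]

lemma abs_ev_sub_le (p : ℝ × HH) (x : ℝ) : |ev p x - p.1| ≤ ‖p.2‖ := by
  unfold ev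
  rw [add_sub_cancel_left]
  calc |inner ℝ (kk x) p.2| ≤ ‖kk x‖ * ‖p.2‖ := abs_real_inner_le_norm _ _
    _ ≤ 1 * ‖p.2‖ := by gcongr; exact norm_kk_le x
    _ = _ := one_mul _

lemma abs_ev_le (p : ℝ × HH) (x : ℝ) : |ev p x| ≤ |p.1| + ‖p.2‖ := by
  have := abs_ev_sub_le p x
  have h2 := abs_add_le (ev p x - p.1) p.1
  rw [sub_add_cancel] at h2
  linarith

lemma pev_le (p : ℝ × HH) (x : ℝ) : pev p x ≤ |p.1| + ‖p.2‖ :=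
  max_le ((le_abs_self _).trans (abs_ev_le p x)) (by positivity)

lemma ev_add_smul (p h : ℝ × HH) (e x : ℝ) : ev (p + e • h) x = ev p x + e * ev h x := by
  simp only [ev, Prod.fst_add, Prod.snd_add, Prod.smul_fst, Prod.smul_snd, inner_add_right,
    inner_smul_right, smul_eq_mul]
  ring

lemma ev_smul (p : ℝ × HH) (e x : ℝ) : ev (e • p) x = e * ev p x := by
  simp only [ev, Prod.smul_fst, Prod.smul_snd, inner_smul_right, smul_eq_mul]
  ring

lemma wev_smul (p : ℝ × HH) (e x : ℝ) (he : 0 ≤ e) : wev (e • p) x = e ^ 2 * wev p x := by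
  unfold wev pev
  rw [ev_smul, ← mul_pow, mul_max_of_nonneg _ _ he, mul_zero]

lemma II_smul (p q : ℝ × HH) (a b : ℝ) (ha : 0 ≤ a) (hb : 0 ≤ b) :
    II (a • p) (b • q) = a ^ 2 * b ^ 2 * II p q := by
  unfold II
  rw [← intervalIntegral.integral_const_mul]
  congr 1; funext x
  rw [wev_smul _ _ _ ha, wev_smul _ _ _ hb]; ring

lemma II_comm (p q : ℝ × HH) : II p q = II q p := by
  unfold II; congr 1; funext x; ring

lemma II_self_nonneg (p : ℝ × HH) : 0 ≤ II p p :=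
  intervalIntegral.integral_nonneg zero_le_one fun x _ => mul_nonneg (wev_nonneg _ _) (wev_nonneg _ _)

section var
variable {ι : Type*} [Fintype ι]

noncomputable def gg (p : ι → ℝ × HH) (i : ι) : ℝ := ‖(p i).2‖ ^ 2
noncomputable def mm (B : ι → ι → ℝ) (p : ι → ℝ × HH) (i j : ι) : ℝ := B i j * II (p i) (p j)

lemma qf_mm (B : ι → ι → ℝ) (p : ι → ℝ × HH) (v : ι → ℝ) :
    qf (mm B p) v = ∫ x in (0:ℝ)..1, qf B (fun i => v i * wev (p i) x) := by
  simp only [qf, mm, II]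
  have hc := fun i => continuous_wev (p i)
  rw [intervalIntegral.integral_finsetSum]
  · refine Finset.sum_congr rfl fun i _ => ?_
    rw [intervalIntegral.integral_finsetSum]
    · refine Finset.sum_congr rfl fun j _ => ?_
      rw [mul_assoc, mul_assoc, mul_comm (∫ x in (0:ℝ)..1, wev (p i) x * wev (p j) x), ← mul_assoc,
        ← intervalIntegral.integral_const_mul]
      congr 1; funext x; ring
    · intro j _; apply Continuous.intervalIntegrable; fun_prop
  · intro i _; apply Continuous.intervalIntegrable; fun_prop

def PP (B : ι → ι → ℝ) (p : ι → ℝ × HH) (c : ℝ) : Prop :=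
  ∀ s : ι → ℝ, (∀ i, 0 ≤ s i) → psi (gg p) (mm B p) s ≤ c

lemma psi_smul (g : ι → ℝ) (m : ι → ι → ℝ) (s : ι → ℝ) (t : ℝ) :
    psi g m (t • s) = t * (∑ i, g i * s i) / 2 - t ^ 2 * qf m s / 4 := by
  unfold psi
  rw [qf_smul, Finset.mul_sum]
  congr 2
  refine Finset.sum_congr rfl fun i _ => ?_
  simp only [Pi.smul_apply, smul_eq_mul]; ring

structure HB (B : ι → ι → ℝ) (c : ι → ℝ) : Prop where
  sym : ∀ i j, B i j = B j i
  nonneg : ∀ i, 0 ≤ c i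
  neg : qf B c < 0
  H2 : ∀ d : ι → ℝ, (∀ i, 0 ≤ d i) → d ≠ 0 → (∃ i, d i = 0) → 0 < qf B d
  diag : ∀ i, 0 < B i i

lemma exists_wev_pos {p : ℝ × HH} (h : II p p ≠ 0) : ∃ x ∈ Set.Icc (0:ℝ) 1, 0 < wev p x := by
  by_contra! hcon
  apply h
  unfold II
  rw [intervalIntegral.integral_congr (g := fun _ => 0)]
  · simp
  · intro x hx
    rw [Set.uIcc_of_le zero_le_one] at hx
    have := le_antisymm (hcon x hx) (wev_nonneg p x)
    simp [this]

lemma const_wev {p : ℝ × HH} (hp : p.2 = 0) (x : ℝ) : wev p x = (max p.1 0) ^ 2 := by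
  simp [wev, pev, ev, hp]

lemma mm_pd {B : ι → ι → ℝ} {c : ι → ℝ} (hB : HB B c) (p : ι → ℝ × HH)
    (hp : ∀ i, II (p i) (p i) = 1) (C : ℝ) (hP : PP B p C) (v : ι → ℝ) (hv : v ≠ 0) :
    0 < qf (mm B p) v := by
  -- copositivity
  have hcop : ∀ s : ι → ℝ, (∀ i, 0 ≤ s i) → 0 ≤ qf (mm B p) s ∧
      (qf (mm B p) s = 0 → ∑ i, gg p i * s i = 0) := by
    intro s hs
    have hlin : 0 ≤ ∑ i, gg p i * s i :=
      Finset.sum_nonneg fun i _ => mul_nonneg (sq_nonneg _) (hs i)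
    have key : ∀ t : ℝ, 0 ≤ t → t * (∑ i, gg p i * s i) / 2 - t ^ 2 * qf (mm B p) s / 4 ≤ C := by
      intro t ht
      rw [← psi_smul]
      exact hP _ fun i => mul_nonneg ht (hs i)
    constructor
    · by_contra! hneg
      have hC : 0 ≤ C := by simpa using key 0 le_rfl
      set q := -qf (mm B p) s with hq
      have hqp : 0 < q := by linarith
      have h1 := key (1 + 4 * (C + 1) / q) (by positivity)
      have h2 : 0 ≤ (1 + 4 * (C + 1) / q) * (∑ i, gg p i * s i) := by positivity
      have h3 : (1 + 4 * (C + 1) / q) * q = q + 4 * (C + 1) := by field_simp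
      have h4 : (1 + 4 * (C + 1) / q) ≤ (1 + 4 * (C + 1) / q) ^ 2 := by
        have : 0 ≤ 4 * (C + 1) / q := by positivity
        nlinarith
      have h5 := mul_le_mul_of_nonneg_right h4 hqp.le
      have h6 : (1 + 4 * (C + 1) / q) ^ 2 * qf (mm B p) s = -((1 + 4 * (C + 1) / q) ^ 2 * q) := by
        rw [hq]; ring
      rw [h6] at h1
      linarith
    · intro h0
      by_contra hne
      have hpos : 0 < ∑ i, gg p i * s i := lt_of_le_of_ne hlin (Ne.symm hne)
      set L := ∑ i, gg p i * s i
      have hC : 0 ≤ C := by simpa using key 0 le_rfl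
      have := key (2 * (C + 1) / L) (by positivity)
      rw [h0] at this
      have h3 : 2 * (C + 1) / L * L = 2 * (C + 1) := by field_simp
      linarith
  have hcw := fun i => continuous_wev (p i)
  have mixed : (∃ i, v i ≤ 0) → (∃ i, 0 ≤ v i) → 0 < qf (mm B p) v := by
    rintro ⟨i1, hi1⟩ ⟨i2, hi2⟩
    rw [qf_mm]
    have hpt : ∀ x, (fun i => v i * wev (p i) x) ≠ 0 → 0 < qf B (fun i => v i * wev (p i) x) := by
      intro x hx
      refine qf_mixed_pos B hB.sym c hB.nonneg hB.neg hB.H2 _ hx ⟨i1, ?_⟩ ⟨i2, ?_⟩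
      · exact mul_nonpos_of_nonpos_of_nonneg hi1 (wev_nonneg _ _)
      · exact mul_nonneg hi2 (wev_nonneg _ _)
    apply intervalIntegral.integral_pos zero_lt_one
    · apply Continuous.continuousOn; unfold qf; fun_prop
    · intro x _
      by_cases hx : (fun i => v i * wev (p i) x) = 0
      · rw [hx]; simp [qf]
      · exact (hpt x hx).le
    · obtain ⟨i, hi⟩ := Function.ne_iff.1 hv
      obtain ⟨x, hx, hxw⟩ := exists_wev_pos (p := p i) (by rw [hp]; exact one_ne_zero)
      refine ⟨x, hx, hpt x ?_⟩
      intro h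
      have := congrFun h i
      simp only [Pi.zero_apply, mul_eq_zero] at this
      rcases this with h | h
      · exact hi h
      · linarith
  have posv : ∀ v : ι → ℝ, v ≠ 0 → (∀ i, 0 < v i) → 0 < qf (mm B p) v := by
    intro v hv hpos
    obtain ⟨h1, h2⟩ := hcop v fun i => (hpos i).le
    refine lt_of_le_of_ne h1 fun h0 => ?_
    have h3 := h2 h0.symm
    have hnn : ∀ i ∈ Finset.univ, 0 ≤ gg p i * v i := fun i _ =>
      mul_nonneg (sq_nonneg _) (hpos i).le
    rw [Finset.sum_eq_zero_iff_of_nonneg hnn] at h3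
    have h4 : ∀ i, (p i).2 = 0 := by
      intro i
      have := h3 i (Finset.mem_univ i)
      rcases mul_eq_zero.1 this with h | h
      · simpa [gg] using h
      · exact absurd h (hpos i).ne'
    have h5 : ∀ i, max (p i).1 0 ^ 2 = 1 := by
      intro i
      have := hp i
      simp only [II, const_wev (h4 i), intervalIntegral.integral_const] at this
      norm_num at this
      nlinarith [sq_nonneg (max (p i).1 0)]
    have h6 : mm B p = B := by
      funext i j
      simp [mm, II, const_wev (h4 _), h5]
    have := (hcop c hB.nonneg).1
    rw [h6] at this
    linarith [hB.neg]
  by_cases h1 : ∃ i, v i ≤ 0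
  · by_cases h2 : ∃ i, 0 ≤ v i
    · exact mixed h1 h2
    · push Not at h2
      rw [← qf_neg]
      exact posv (-v) (by simpa using hv) fun i => by simpa using h2 i
  · push Not at h1
    exact posv v hv h1

lemma normalize_st (B : ι → ι → ℝ) (p : ι → ℝ × HH) (hp : ∀ i, 0 < II (p i) (p i)) (c : ℝ)
    (hP : PP B p c) : ∃ p' : ι → ℝ × HH, (∀ i, II (p' i) (p' i) = 1) ∧ PP B p' c := by
  set l : ι → ℝ := fun i => Real.sqrt (Real.sqrt (II (p i) (p i))⁻¹) with hl
  have hl0 : ∀ i, 0 ≤ l i := fun i => Real.sqrt_nonneg _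
  have hl4 : ∀ i, l i ^ 2 * l i ^ 2 = (II (p i) (p i))⁻¹ := by
    intro i
    rw [hl]; simp only
    rw [Real.sq_sqrt (Real.sqrt_nonneg _), Real.mul_self_sqrt (by have := hp i; positivity)]
  refine ⟨fun i => l i • p i, fun i => ?_, ?_⟩
  · rw [II_smul _ _ _ _ (hl0 i) (hl0 i), hl4, inv_mul_cancel₀ (hp i).ne']
  · intro s hs
    have := hP (fun i => l i ^ 2 * s i) fun i => mul_nonneg (sq_nonneg _) (hs i)
    refine le_of_eq_of_le ?_ this
    unfold psi qf
    congr 2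
    · refine Finset.sum_congr rfl fun i _ => ?_
      simp only [gg, Prod.smul_snd, norm_smul, mul_pow, Real.norm_eq_abs, sq_abs]
      ring
    · refine Finset.sum_congr rfl fun i _ => Finset.sum_congr rfl fun j _ => ?_
      simp only [mm, II_smul _ _ _ _ (hl0 i) (hl0 j)]
      ring

lemma exists_tents {B : ι → ι → ℝ} (hB : ∀ i, 0 < B i i) :
    ∃ (p : ι → ℝ × HH) (c : ℝ), (∀ i, 0 < II (p i) (p i)) ∧ PP B p c := by
  by_cases hne : Nonempty ι
  swap
  · rw [not_nonempty_iff] at hne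
    refine ⟨fun _ => 0, 0, fun i => (hne.false i).elim, fun s _ => ?_⟩
    simp [psi, qf]
  obtain ⟨n, hn⟩ : ∃ n : ℝ, n = ((Fintype.card ι : ℕ) : ℝ) := ⟨_, rfl⟩
  have hnpos : 0 < n := by rw [hn]; exact_mod_cast Fintype.card_pos
  set q : ι → ℝ := fun i => ((Fintype.equivFin ι i : ℕ) : ℝ) / n with hq
  have hq0 : ∀ i, 0 ≤ q i := fun i => by positivity
  have hq1 : ∀ i, q i ≤ 1 := fun i => by
    rw [hq]; simp only
    rw [div_le_one hnpos, hn]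
    exact_mod_cast (Fintype.equivFin ι i).2.le
  have hsep : ∀ i j, i ≠ j → 1 / n ≤ |q i - q j| := by
    intro i j hij
    rw [hq]; simp only
    rw [← sub_div, abs_div, abs_of_pos hnpos]
    gcongr
    have : (Fintype.equivFin ι i : ℕ) ≠ (Fintype.equivFin ι j : ℕ) := by
      intro h; exact hij ((Fintype.equivFin ι).injective (Fin.ext h))
    have h2 : (1:ℤ) ≤ |((Fintype.equivFin ι i : ℕ) : ℤ) - ((Fintype.equivFin ι j : ℕ) : ℤ)| := by
      apply Int.one_le_abs; omega
    exact_mod_cast h2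
  set K := 2 * n with hK
  set p : ι → ℝ × HH := fun i => (1 - K * q i, (2 * K) • kk (q i) - K • kk 1) with hp
  have hev : ∀ i, ∀ x ∈ Set.Icc (0:ℝ) 1, ev (p i) x = 1 - K * |x - q i| := by
    intro i x hx
    simp only [ev, hp, inner_sub_right, inner_smul_right, inner_kk]
    rw [fold_of_mem hx.1 hx.2, fold_of_mem (hq0 i) (hq1 i), fold_of_mem zero_le_one le_rfl,
      min_eq_left hx.2]
    rcases le_total x (q i) with h | h
    · rw [min_eq_left h, abs_of_nonpos (by linarith)]; ring
    · rw [min_eq_right h, abs_of_nonneg (by linarith)]; ring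
  have hII : ∀ i, 0 < II (p i) (p i) := by
    intro i
    have hc := continuous_wev (p i)
    apply intervalIntegral.integral_pos zero_lt_one
    · fun_prop
    · intro x _; exact mul_nonneg (wev_nonneg _ _) (wev_nonneg _ _)
    · refine ⟨q i, ⟨hq0 i, hq1 i⟩, ?_⟩
      simp [wev, pev, hev i (q i) ⟨hq0 i, hq1 i⟩]
  have hII0 : ∀ i j, i ≠ j → II (p i) (p j) = 0 := by
    intro i j hij
    unfold II
    rw [intervalIntegral.integral_congr (g := fun _ => 0)]
    · simp
    · intro x hx
      rw [Set.uIcc_of_le zero_le_one] at hx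
      simp only [wev, pev, hev _ x hx]
      have h1 := hsep i j hij
      have h2 : |q i - q j| ≤ |x - q i| + |x - q j| := by
        have := abs_sub_le (q i) x (q j)
        rwa [abs_sub_comm (q i) x] at this
      have h3 : 2 ≤ K * |x - q i| + K * |x - q j| := by
        have : 1 / n ≤ |x - q i| + |x - q j| := h1.trans h2
        rw [div_le_iff₀ hnpos] at this
        rw [hK]; nlinarith
      rcases le_total (1 - K * |x - q i|) 0 with h | h
      · rw [max_eq_right h]; ring
      · rw [max_eq_right (a := 1 - K * |x - q j|) (by linarith)]; ring
  refine ⟨p, ∑ i, gg p i ^ 2 / (4 * mm B p i i), hII, ?_⟩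
  intro s hs
  have hd : qf (mm B p) s = ∑ i, mm B p i i * s i ^ 2 := by
    unfold qf
    refine Finset.sum_congr rfl fun i _ => ?_
    rw [Finset.sum_eq_single i]
    · ring
    · intro j _ hj
      simp [mm, hII0 i j hj.symm]
    · simp
  unfold psi
  rw [hd, Finset.sum_div, Finset.sum_div, ← Finset.sum_sub_distrib]
  refine Finset.sum_le_sum fun i _ => ?_
  have hm : 0 < mm B p i i := mul_pos (hB i) (hII i)
  rw [le_div_iff₀ (by positivity)]
  nlinarith [sq_nonneg (gg p i - mm B p i i * s i)]
end var

end part4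

section part5
section minim
open Filter Topology

lemma II_tendsto (p q : ℕ → ℝ × HH) (p0 q0 : ℝ × HH) (M : ℝ)
    (hp : ∀ k, |(p k).1| + ‖(p k).2‖ ≤ M) (hq : ∀ k, |(q k).1| + ‖(q k).2‖ ≤ M)
    (hpe : ∀ x, Tendsto (fun k => ev (p k) x) atTop (𝓝 (ev p0 x)))
    (hqe : ∀ x, Tendsto (fun k => ev (q k) x) atTop (𝓝 (ev q0 x))) :
    Tendsto (fun k => II (p k) (q k)) atTop (𝓝 (II p0 q0)) := by
  unfold II
  refine intervalIntegral.tendsto_integral_filter_of_dominated_convergence (fun _ => M ^ 2 * M ^ 2)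
    ?_ ?_ ?_ ?_
  · refine Eventually.of_forall fun k => ?_
    exact ((continuous_wev (p k)).mul (continuous_wev (q k))).aestronglyMeasurable
  · refine Eventually.of_forall fun k => Eventually.of_forall fun x _ => ?_
    rw [Real.norm_of_nonneg (mul_nonneg (wev_nonneg _ _) (wev_nonneg _ _))]
    have h1 := pev_nonneg (p k) x
    have h2 := pev_nonneg (q k) x
    have h3 := (pev_le (p k) x).trans (hp k)
    have h4 := (pev_le (q k) x).trans (hq k)
    unfold wev
    gcongr
  · exact intervalIntegrable_const
  · refine Eventually.of_forall fun x _ => ?_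
    unfold wev pev
    exact (((hpe x).max tendsto_const_nhds).pow 2).mul (((hqe x).max tendsto_const_nhds).pow 2)

lemma abs_fst_le (p : ℝ × HH) (hp : II p p = 1) : |p.1| ≤ ‖p.2‖ + 1 := by
  have hb := fun x => abs_le.1 (abs_ev_sub_le p x)
  have hn := norm_nonneg p.2
  rw [abs_le]
  constructor
  · by_contra! hcon
    obtain ⟨x, _, hx⟩ := exists_wev_pos (p := p) (by rw [hp]; exact one_ne_zero)
    have : pev p x = 0 := max_eq_right (by linarith [(hb x).2])
    simp [wev, this] at hx
  · by_contra! hcon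
    obtain ⟨r, hr, hr2⟩ := exists_between hcon
    have hr1 : 1 < r - ‖p.2‖ := by linarith
    have h1 : ∀ x, p.1 - ‖p.2‖ ≤ pev p x := fun x => le_max_of_le_left (by linarith [(hb x).1])
    have h2 : ∀ x, 1 < wev p x := fun x => by
      unfold wev; nlinarith [h1 x]
    have hc := continuous_wev p
    have : (0:ℝ) < ∫ x in (0:ℝ)..1, (wev p x * wev p x - 1) := by
      apply intervalIntegral.integral_pos zero_lt_one
      · fun_prop
      · intro x _; nlinarith [h2 x]
      · exact ⟨0, by simp, by nlinarith [h2 0]⟩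
    rw [intervalIntegral.integral_sub (by apply Continuous.intervalIntegrable; fun_prop)
      (by simp)] at this
    unfold II at hp
    rw [hp] at this
    simp at this

variable {ι : Type*} [Fintype ι]

lemma common_subseq (p : ℕ → ι → ℝ × HH) (M : ℝ) (hp : ∀ k i, |(p k i).1| ≤ M ∧ ‖(p k i).2‖ ≤ M)
    (T : Finset ι) : ∃ (φ : ℕ → ℕ) (p0 : ι → ℝ × HH), StrictMono φ ∧ ∀ i ∈ T,
      Tendsto (fun k => (p (φ k) i).1) atTop (𝓝 (p0 i).1) ∧
      ∀ h : HH, Tendsto (fun k => (inner ℝ h (p (φ k) i).2 : ℝ)) atTop (𝓝 (inner ℝ h (p0 i).2)) := by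
  classical
  induction T using Finset.induction_on with
  | empty => exact ⟨id, fun _ => 0, strictMono_id, by simp⟩
  | insert i T hi ih =>
    obtain ⟨φ, p0, hφ, h0⟩ := ih
    obtain ⟨g, φ1, hφ1, hg⟩ := weak_compact (fun k => (p (φ k) i).2) M (fun k => (hp _ i).2)
    obtain ⟨a, _, φ2, hφ2, ha⟩ := (isCompact_Icc (a := -M) (b := M)).tendsto_subseq
      (x := fun k => (p (φ (φ1 k)) i).1) (fun k => abs_le.1 (hp _ i).1)
    refine ⟨φ ∘ φ1 ∘ φ2, Function.update p0 i (a, g), hφ.comp (hφ1.comp hφ2), ?_⟩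
    intro j hj
    by_cases hji : j = i
    · subst hji
      simp only [Function.update_self]
      exact ⟨ha, fun h => (hg h).comp hφ2.tendsto_atTop⟩
    · have hjT : j ∈ T := by
        rcases Finset.mem_insert.1 hj with h | h
        · exact absurd h hji
        · exact h
      simp only [Function.update_of_ne hji]
      exact ⟨(h0 j hjT).1.comp (hφ1.comp hφ2).tendsto_atTop,
        fun h => ((h0 j hjT).2 h).comp (hφ1.comp hφ2).tendsto_atTop⟩

lemma gg_bound {B : ι → ι → ℝ} (hB : ∀ i, 0 < B i i) (p : ι → ℝ × HH)
    (hp : ∀ i, II (p i) (p i) = 1) (c : ℝ) (hP : PP B p c) (i : ι) :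
    gg p i ^ 2 ≤ 4 * B i i * c := by
  classical
  have hg : 0 ≤ gg p i := sq_nonneg _
  have := hP (Pi.single i (gg p i / B i i)) (fun j => by
    by_cases h : j = i
    · subst h; simp only [Pi.single_eq_same]; have := hB j; positivity
    · simp [Pi.single_eq_of_ne h])
  unfold psi qf at this
  rw [Finset.sum_eq_single i (by intro j _ hj; simp [Pi.single_eq_of_ne hj]) (by simp),
    Finset.sum_eq_single i (by intro j _ hj; simp [Pi.single_eq_of_ne hj]) (by simp),
    Finset.sum_eq_single i (by intro j _ hj; simp [Pi.single_eq_of_ne hj]) (by simp)] at this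
  simp only [Pi.single_eq_same, mm, hp, mul_one] at this
  have hb := hB i
  have e : gg p i * (gg p i / B i i) / 2 - B i i * (gg p i / B i i) * (gg p i / B i i) / 4
      = gg p i ^ 2 / (4 * B i i) := by field_simp; ring
  rw [e, div_le_iff₀ (by positivity)] at this
  linarith

def CS (B : ι → ι → ℝ) : Set ℝ := {c | ∃ p : ι → ℝ × HH, (∀ i, II (p i) (p i) = 1) ∧ PP B p c}

lemma PP_nonneg {B : ι → ι → ℝ} {p : ι → ℝ × HH} {c : ℝ} (h : PP B p c) : 0 ≤ c := by
  have := h (fun _ => 0) (fun _ => le_rfl)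
  simpa [psi, qf] using this

lemma CS_bdd (B : ι → ι → ℝ) : BddBelow (CS B) := ⟨0, fun _ ⟨_, _, h⟩ => PP_nonneg h⟩

lemma CS_nonempty {B : ι → ι → ℝ} (hB : ∀ i, 0 < B i i) : (CS B).Nonempty := by
  obtain ⟨p, c, h1, h2⟩ := exists_tents hB
  obtain ⟨p', h3, h4⟩ := normalize_st B p h1 c h2
  exact ⟨c, p', h3, h4⟩

lemma exists_minimizer {B : ι → ι → ℝ} (hB : ∀ i, 0 < B i i) :
    ∃ p : ι → ℝ × HH, (∀ i, II (p i) (p i) = 1) ∧ PP B p (sInf (CS B)) := by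
  obtain ⟨c, hcm, hct, hcS⟩ := exists_seq_tendsto_sInf (CS_nonempty hB) (CS_bdd B)
  choose p hp hP using hcS
  have hc0 : ∀ k, c k ≤ c 0 := fun k => hcm (Nat.zero_le k)
  have hc0' : 0 ≤ c 0 := PP_nonneg (hP 0)
  set R : ℝ := ∑ i, (1 + 4 * B i i * c 0) with hR
  have hterm : ∀ i, 1 + 4 * B i i * c 0 ≤ R := fun i =>
    Finset.single_le_sum (f := fun i => 1 + 4 * B i i * c 0)
      (fun j _ => by have := hB j; positivity) (Finset.mem_univ i)
  have hfb : ∀ k i, ‖(p k i).2‖ ≤ R + 1 := by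
    intro k i
    have h1 := gg_bound hB (p k) (hp k) (c k) (hP k) i
    have h2 : 4 * B i i * c k ≤ 4 * B i i * c 0 := by
      have := hB i; have := hc0 k; gcongr
    have h3 := hterm i
    have h4 : gg (p k) i = ‖(p k i).2‖ ^ 2 := rfl
    by_contra! hcon
    have hb := hB i
    have hR1 : 1 ≤ R := by
      have : 0 ≤ 4 * B i i * c 0 := by positivity
      linarith
    have h5 : R ≤ gg (p k) i := by rw [h4]; nlinarith
    nlinarith
  have hab : ∀ k i, |(p k i).1| ≤ R + 2 := fun k i => by
    linarith [abs_fst_le (p k i) (hp k i), hfb k i]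
  obtain ⟨φ, p0, hφ, hconv⟩ := common_subseq p (R + 2)
    (fun k i => ⟨hab k i, by linarith [hfb k i]⟩) Finset.univ
  have hev : ∀ i x, Tendsto (fun k => ev (p (φ k) i) x) atTop (𝓝 (ev (p0 i) x)) := fun i x => by
    unfold ev
    exact (hconv i (Finset.mem_univ _)).1.add ((hconv i (Finset.mem_univ _)).2 _)
  have hII : ∀ i j, Tendsto (fun k => II (p (φ k) i) (p (φ k) j)) atTop (𝓝 (II (p0 i) (p0 j))) :=
    fun i j => II_tendsto _ _ _ _ ((R + 2) + (R + 1)) (fun k => add_le_add (hab _ _) (hfb _ _))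
      (fun k => add_le_add (hab _ _) (hfb _ _)) (hev i) (hev j)
  refine ⟨p0, fun i => ?_, fun s hs => ?_⟩
  · have := hII i i
    simp only [hp] at this
    exact (tendsto_nhds_unique this tendsto_const_nhds)
  · -- lower bound
    have h1 : ∀ k, (∑ i, (2 * inner ℝ (p0 i).2 (p (φ k) i).2 - ‖(p0 i).2‖ ^ 2) * s i) / 2
        - qf (mm B (p (φ k))) s / 4 ≤ c (φ k) := by
      intro k
      refine le_trans ?_ (hP (φ k) s hs)
      unfold psi
      gcongr with i _
      · exact hs i
      · unfold gg
        have := norm_sub_sq_real (p0 i).2 (p (φ k) i).2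
        nlinarith [sq_nonneg ‖(p0 i).2 - (p (φ k) i).2‖]
    have h2 : Tendsto (fun k => (∑ i, (2 * inner ℝ (p0 i).2 (p (φ k) i).2 - ‖(p0 i).2‖ ^ 2) * s i) / 2
        - qf (mm B (p (φ k))) s / 4) atTop (𝓝 (psi (gg p0) (mm B p0) s)) := by
      unfold psi
      refine Tendsto.sub (Tendsto.div_const ?_ 2) (Tendsto.div_const ?_ 4)
      · refine tendsto_finsetSum _ fun i _ => Tendsto.mul_const _ ?_
        have h3 := (((hconv i (Finset.mem_univ _)).2 (p0 i).2).const_mul 2).sub_const (‖(p0 i).2‖ ^ 2)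
        have h4 : (2 * inner ℝ (p0 i).2 (p0 i).2 - ‖(p0 i).2‖ ^ 2 : ℝ) = gg p0 i := by
          rw [real_inner_self_eq_norm_sq]; unfold gg; ring
        rwa [h4] at h3
      · unfold qf
        refine tendsto_finsetSum _ fun i _ => tendsto_finsetSum _ fun j _ => ?_
        exact (((hII i j).const_mul _).mul_const _).mul_const _
    exact le_of_tendsto_of_tendsto' h2 (hct.comp hφ.tendsto_atTop) h1
end minim

end part5

section part6
section deriv1
open Filter Topology

lemma hasDerivAt_possq (t : ℝ) : HasDerivAt (fun t : ℝ => max t 0 ^ 2) (2 * max t 0) t := by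
  rcases lt_trichotomy t 0 with h | h | h
  · rw [max_eq_right h.le, mul_zero]
    refine (hasDerivAt_const t (0:ℝ)).congr_of_eventuallyEq ?_
    filter_upwards [Iio_mem_nhds h] with s hs
    rw [max_eq_right (le_of_lt hs)]; ring
  · subst h
    rw [hasDerivAt_iff_isLittleO]
    have h1 : (fun s : ℝ => s ^ 2) =o[𝓝 0] fun s : ℝ => s := by
      simpa using Asymptotics.isLittleO_pow_id (𝕜 := ℝ) (n := 2) (by norm_num)
    have h2 : (fun s : ℝ => max s 0 ^ 2) =O[𝓝 0] fun s : ℝ => s ^ 2 := by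
      refine Asymptotics.IsBigO.of_bound 1 (Eventually.of_forall fun s => ?_)
      rw [Real.norm_of_nonneg (sq_nonneg _), Real.norm_of_nonneg (sq_nonneg _), one_mul]
      rcases le_total s 0 with h | h
      · rw [max_eq_right h]; nlinarith [sq_nonneg s]
      · rw [max_eq_left h]
    simpa using h2.trans_isLittleO h1
  · rw [max_eq_left h.le]
    have : HasDerivAt (fun t : ℝ => t ^ 2) (2 * t) t := by simpa using hasDerivAt_pow 2 t
    refine this.congr_of_eventuallyEq ?_
    filter_upwards [Ioi_mem_nhds h] with s hs
    rw [max_eq_left (le_of_lt hs)]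

lemma wev_deriv (p h : ℝ × HH) (x e : ℝ) :
    HasDerivAt (fun e => wev (p + e • h) x) (2 * pev (p + e • h) x * ev h x) e := by
  unfold wev pev
  simp only [ev_add_smul]
  have h1 : HasDerivAt (fun e : ℝ => ev p x + e * ev h x) (ev h x) e := by
    simpa using ((hasDerivAt_id e).mul_const (ev h x)).const_add (ev p x)
  exact (hasDerivAt_possq _).comp e h1

lemma pev_line_le (p h : ℝ × HH) (x e : ℝ) (he : |e| ≤ 1) :
    pev (p + e • h) x ≤ |p.1| + ‖p.2‖ + (|h.1| + ‖h.2‖) := by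
  refine max_le ?_ (by positivity)
  rw [ev_add_smul]
  have h1 := le_trans (le_abs_self _) (abs_ev_le p x)
  have h2 := abs_ev_le h x
  have h3 : e * ev h x ≤ |e| * |ev h x| := by rw [← abs_mul]; exact le_abs_self _
  have h4 : |e| * |ev h x| ≤ 1 * |ev h x| := by gcongr
  linarith

lemma II_deriv (p q h k : ℝ × HH) :
    HasDerivAt (fun e : ℝ => II (p + e • h) (q + e • k))
      (∫ x in (0:ℝ)..1, (2 * pev p x * ev h x * wev q x + wev p x * (2 * pev q x * ev k x))) 0 := by
  set M : ℝ := |p.1| + ‖p.2‖ + (|h.1| + ‖h.2‖) + (|q.1| + ‖q.2‖ + (|k.1| + ‖k.2‖)) with hM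
  have hM1 : |h.1| + ‖h.2‖ ≤ M := by
    have : 0 ≤ |p.1| + ‖p.2‖ + (|q.1| + ‖q.2‖ + (|k.1| + ‖k.2‖)) := by positivity
    linarith
  have hM2 : |k.1| + ‖k.2‖ ≤ M := by
    have : 0 ≤ |p.1| + ‖p.2‖ + (|h.1| + ‖h.2‖) + (|q.1| + ‖q.2‖) := by positivity
    linarith
  have hM3 : |p.1| + ‖p.2‖ + (|h.1| + ‖h.2‖) ≤ M := by
    have : 0 ≤ (|q.1| + ‖q.2‖ + (|k.1| + ‖k.2‖)) := by positivity
    linarith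
  have hM4 : |q.1| + ‖q.2‖ + (|k.1| + ‖k.2‖) ≤ M := by
    have : 0 ≤ |p.1| + ‖p.2‖ + (|h.1| + ‖h.2‖) := by positivity
    linarith
  have hM0 : 0 ≤ M := by positivity
  set F' : ℝ → ℝ → ℝ := fun e x => 2 * pev (p + e • h) x * ev h x * wev (q + e • k) x
    + wev (p + e • h) x * (2 * pev (q + e • k) x * ev k x) with hF'
  have hcp := continuous_pev
  have hcw := continuous_wev
  have hce := continuous_ev
  have := intervalIntegral.hasDerivAt_integral_of_dominated_loc_of_deriv_le (μ := MeasureTheory.volume)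
    (F := fun e x => wev (p + e • h) x * wev (q + e • k) x) (F' := F') (x₀ := (0:ℝ))
    (s := Metric.ball 0 1) (bound := fun _ => 2 * M * M * M ^ 2 + M ^ 2 * (2 * M * M))
    (a := 0) (b := 1) (Metric.ball_mem_nhds _ one_pos)
    (Eventually.of_forall fun e => by
      apply Continuous.aestronglyMeasurable; fun_prop)
    (by apply Continuous.intervalIntegrable; fun_prop)
    (by apply Continuous.aestronglyMeasurable; fun_prop)
    (Eventually.of_forall fun x _ e he => by
      have he1 : |e| ≤ 1 := by
        rw [Metric.mem_ball, dist_zero_right] at he; exact he.le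
      have a1 := pev_nonneg (p + e • h) x
      have a2 := (pev_line_le p h x e he1).trans hM3
      have b1 := pev_nonneg (q + e • k) x
      have b2 := (pev_line_le q k x e he1).trans hM4
      have c1 := (abs_ev_le h x).trans hM1
      have c2 := (abs_ev_le k x).trans hM2
      rw [hF']
      simp only [Real.norm_eq_abs]
      refine (abs_add_le _ _).trans ?_
      simp only [abs_mul, wev, abs_pow, abs_of_nonneg a1, abs_of_nonneg b1, abs_two]
      gcongr)
    intervalIntegrable_const
    (Eventually.of_forall fun x _ e _ => (wev_deriv p h x e).mul (wev_deriv q k x e))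
  have h2 := this.2
  simp only [hF', zero_smul, add_zero] at h2
  exact h2

lemma gg_deriv (p h : ℝ × HH) :
    HasDerivAt (fun e : ℝ => ‖(p + e • h).2‖ ^ 2) (2 * inner ℝ p.2 h.2) 0 := by
  have e1 : (fun e : ℝ => ‖(p + e • h).2‖ ^ 2) =
      fun e => ‖p.2‖ ^ 2 + 2 * (e * inner ℝ p.2 h.2) + e ^ 2 * ‖h.2‖ ^ 2 := by
    funext e
    simp only [Prod.snd_add, Prod.smul_snd]
    rw [norm_add_sq_real, inner_smul_right, norm_smul, mul_pow, Real.norm_eq_abs, sq_abs]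
  rw [e1]
  have := (((hasDerivAt_id (0:ℝ)).mul_const (inner ℝ p.2 h.2 : ℝ)).const_mul 2).const_add (‖p.2‖ ^ 2)
  have h2 := this.add ((hasDerivAt_pow 2 (0:ℝ)).mul_const (‖h.2‖ ^ 2))
  refine h2.congr_deriv ?_
  simp

variable {ι : Type*} [Fintype ι]

lemma hge_of_inf {B : ι → ι → ℝ} (p : ι → ℝ × HH) (hp : ∀ i, 0 < II (p i) (p i)) (η : ℝ) (hη : 0 < η) :
    ∃ s : ι → ℝ, (∀ i, 0 ≤ s i) ∧ sInf (CS B) - η < psi (gg p) (mm B p) s := by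
  by_contra! hcon
  obtain ⟨p', h1, h2⟩ := normalize_st B p hp (sInf (CS B) - η) hcon
  have := csInf_le (CS_bdd B) ⟨p', h1, h2⟩
  linarith

lemma euler {B : ι → ι → ℝ} {c : ι → ℝ} (hB : HB B c) (p : ι → ℝ × HH)
    (hp : ∀ i, II (p i) (p i) = 1) (hP : PP B p (sInf (CS B))) (t : ι → ℝ) (ht : ∀ i, 0 ≤ t i)
    (htc : psi (gg p) (mm B p) t = sInf (CS B)) (i : ι) (hti : 0 < t i) (d : ℝ × HH) :
    (inner ℝ (p i).2 d.2 : ℝ) = ∫ x in (0:ℝ)..1, (∑ j, B i j * t j * wev (p j) x) * pev (p i) x * ev d x := by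
  classical
  set h : ι → ℝ × HH := Pi.single i d with hh
  have hI0 : ∀ i j, HasDerivAt (fun e : ℝ => II (p i + e • h i) (p j + e • h j)) _ 0 := fun i j =>
    II_deriv (p i) (p j) (h i) (h j)
  have key := envelope (fun e => gg (p + e • h)) (fun e => mm B (p + e • h))
    (fun i => 2 * inner ℝ (p i).2 (h i).2)
    (fun i j => B i j * ∫ x in (0:ℝ)..1, (2 * pev (p i) x * ev (h i) x * wev (p j) x
      + wev (p i) x * (2 * pev (p j) x * ev (h j) x)))
    (fun i => gg_deriv (p i) (h i))
    (fun i j => (hI0 i j).const_mul _)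
    (fun v hv => by
      simp only [zero_smul, add_zero]
      exact mm_pd hB p hp _ hP v hv)
    (sInf (CS B))
    (by simp only [zero_smul, add_zero]; exact hP)
    (by
      have hev : ∀ᶠ e in 𝓝 (0:ℝ), ∀ i, 0 < II ((p + e • h) i) ((p + e • h) i) := by
        rw [eventually_all]
        intro i
        have := (hI0 i i).continuousAt
        refine this.eventually (lt_mem_nhds ?_)
        simp [hp]
      filter_upwards [hev] with e he η hη
      exact hge_of_inf _ he η hη)
    t ht (by simpa using htc)
  have hcp := continuous_pev
  have hcw := continuous_wev
  have hce := continuous_ev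
  set J : ι → ℝ := fun j => ∫ x in (0:ℝ)..1, pev (p i) x * ev d x * wev (p j) x with hJ
  have hev0 : ∀ x, ev (0 : ℝ × HH) x = 0 := fun x => by simp [ev]
  have hm' : ∀ k j, (∫ x in (0:ℝ)..1, (2 * pev (p k) x * ev (h k) x * wev (p j) x
      + wev (p k) x * (2 * pev (p j) x * ev (h j) x)))
      = (if k = i then 2 * J j else 0) + (if j = i then 2 * J k else 0) := by
    intro k j
    rw [intervalIntegral.integral_add (by apply Continuous.intervalIntegrable; fun_prop)
      (by apply Continuous.intervalIntegrable; fun_prop)]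
    congr 1
    · by_cases hk : k = i
      · subst hk
        simp only [hh, Pi.single_eq_same, if_true, hJ]
        rw [← intervalIntegral.integral_const_mul]
        congr 1; funext x; ring
      · simp [hh, Pi.single_eq_of_ne hk, hev0, hk]
    · by_cases hk : j = i
      · subst hk
        simp only [hh, Pi.single_eq_same, if_true, hJ]
        rw [← intervalIntegral.integral_const_mul]
        congr 1; funext x; ring
      · simp [hh, Pi.single_eq_of_ne hk, hev0, hk]
  simp only [hm'] at key
  unfold psi qf at key
  have k1 : ∑ k, 2 * inner ℝ (p k).2 (h k).2 * t k = 2 * inner ℝ (p i).2 d.2 * t i := by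
    rw [Finset.sum_eq_single i]
    · simp [hh]
    · intro j _ hj; simp [hh, Pi.single_eq_of_ne hj]
    · simp
  have k2 : ∑ k, ∑ j, B k j * ((if k = i then 2 * J j else 0) + (if j = i then 2 * J k else 0)) * t k * t j
      = 4 * t i * ∑ j, B i j * t j * J j := by
    have e1 : ∀ k j, B k j * ((if k = i then 2 * J j else 0) + (if j = i then 2 * J k else 0)) * t k * t j
      = (if k = i then B k j * 2 * J j * t k * t j else 0)
        + (if j = i then B k j * 2 * J k * t k * t j else 0) := by
      intro k j
      split_ifs <;> ring
    simp only [e1, Finset.sum_add_distrib]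
    rw [Finset.sum_comm (f := fun k j => if k = i then B k j * 2 * J j * t k * t j else 0)]
    simp only [Finset.sum_ite_eq', Finset.mem_univ, if_true]
    rw [← Finset.sum_add_distrib, Finset.mul_sum]
    refine Finset.sum_congr rfl fun j _ => ?_
    rw [hB.sym j i]; ring
  rw [k1, k2] at key
  have k3 : (inner ℝ (p i).2 d.2 : ℝ) = ∑ j, B i j * t j * J j := by
    have : t i * ((inner ℝ (p i).2 d.2 : ℝ) - ∑ j, B i j * t j * J j) = 0 := by linarith
    rcases mul_eq_zero.1 this with h | h
    · exact absurd h hti.ne'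
    · linarith
  rw [k3]
  simp only [hJ, ← intervalIntegral.integral_const_mul]
  rw [← intervalIntegral.integral_finsetSum
    (fun j _ => by apply Continuous.intervalIntegrable; fun_prop)]
  congr 1; funext x
  rw [Finset.sum_mul, Finset.sum_mul]
  refine Finset.sum_congr rfl fun j _ => ?_
  ring

theorem exists_ode {B : ι → ι → ℝ} {c : ι → ℝ} (hB : HB B c) :
    ∃ V V' : ι → ℝ → ℝ, (∀ i x, HasDerivAt (V i) (V' i x) x) ∧
      (∀ i x, HasDerivAt (V' i) (-∑ j, B i j * V j x ^ 2 * V i x) x) ∧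
      (∀ i x, 0 ≤ V i x) ∧ ∃ i, V i ≠ 0 := by
  obtain ⟨p, hp, hP⟩ := exists_minimizer hB.diag
  have hpd := mm_pd hB p hp _ hP
  have hp0 : ∀ i, 0 < II (p i) (p i) := fun i => by rw [hp]; exact one_pos
  obtain ⟨t, ht, htc⟩ := exists_max (gg p) (mm B p) hpd _ hP (fun η hη => hge_of_inf p hp0 η hη)
  have hcp := continuous_pev
  have hcw := continuous_wev
  have hce := continuous_ev
  set G : ι → ℝ → ℝ := fun i x => ∑ j, B i j * t j * wev (p j) x with hG
  -- regularity
  have hreg : ∀ i, 0 < t i → ∃ u' : ℝ → ℝ, (∀ x, HasDerivAt (ev (p i)) (u' x) x) ∧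
      ∀ x, HasDerivAt u' (-(G i x * pev (p i) x)) x := by
    intro i hi
    have hE := euler hB p hp hP t ht htc i hi
    refine ode_of_kernel (F := fun x => G i x * pev (p i) x) (a := (p i).1) ?_ ?_ ?_ ?_ ?_
    · simp only [hG]; fun_prop
    · intro x; simp only [hG, wev, pev, ev_neg]
    · intro x; simp only [hG, wev, pev, ev_add_two]
    · have := hE (1, 0)
      simp only [inner_zero_right, ev, add_zero, mul_one] at this
      exact this.symm
    · intro x
      have := hE (0, kk x)
      simp only [] at this
      rw [ev, real_inner_comm, this]
      congr 1
      congr 1; funext y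
      simp only [ev, zero_add, inner_kk, hG]
      rw [min_comm]
  have hnn : ∀ i, 0 < t i → ∀ x, 0 ≤ ev (p i) x := by
    intro i hi
    obtain ⟨u', h1, h2⟩ := hreg i hi
    refine nonneg_of_ode (G := G i) h1 h2 (fun x => (ev_fold _ _).symm) ?_
    obtain ⟨x, _, hx⟩ := exists_wev_pos (hp0 i).ne'
    refine ⟨x, ?_⟩
    by_contra! hcon
    simp [wev, pev, max_eq_right hcon] at hx
  have hreg' : ∀ i, ∃ u' : ℝ → ℝ, 0 < t i → (∀ x, HasDerivAt (ev (p i)) (u' x) x) ∧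
      ∀ x, HasDerivAt u' (-(G i x * pev (p i) x)) x := by
    intro i
    by_cases hi : 0 < t i
    · obtain ⟨u', h⟩ := hreg i hi
      exact ⟨u', fun _ => h⟩
    · exact ⟨0, fun h => absurd h hi⟩
  choose u' hu' using hreg'
  have hV2 : ∀ i x, (Real.sqrt (t i) * ev (p i) x) ^ 2 = t i * wev (p i) x := by
    intro i x
    rw [mul_pow, Real.sq_sqrt (ht i)]
    rcases (ht i).lt_or_eq with h | h
    · rw [wev, pev, max_eq_left (hnn i h x)]
    · rw [← h]; ring
  refine ⟨fun i x => Real.sqrt (t i) * ev (p i) x, fun i x => Real.sqrt (t i) * u' i x, ?_, ?_, ?_, ?_⟩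
  · intro i x
    rcases (ht i).lt_or_eq with h | h
    · exact ((hu' i h).1 x).const_mul _
    · simp only [← h, Real.sqrt_zero, zero_mul]; exact hasDerivAt_const _ _
  · intro i x
    rcases (ht i).lt_or_eq with h | h
    · refine (((hu' i h).2 x).const_mul _).congr_deriv ?_
      simp only [hV2]
      rw [pev, max_eq_left (hnn i h x), hG, ← Finset.sum_mul]
      simp only [mul_assoc]
      ring
    · simp only [← h, Real.sqrt_zero, zero_mul, mul_zero, Finset.sum_const_zero, neg_zero]
      exact hasDerivAt_const _ _
  · intro i x
    rcases (ht i).lt_or_eq with h | h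
    · exact mul_nonneg (Real.sqrt_nonneg _) (hnn i h x)
    · simp [← h]
  · -- nontrivial
    obtain ⟨i, hi⟩ : ∃ i, 0 < t i := by
      by_contra! hcon
      have ht0 : t = 0 := funext fun i => le_antisymm (hcon i) (ht i)
      have hc0 : sInf (CS B) = 0 := by rw [← htc, ht0]; simp [psi, qf]
      rw [hc0] at hP
      have hg0 : ∀ i, (p i).2 = 0 := by
        intro i
        have := gg_bound hB.diag p hp 0 hP i
        have : gg p i = 0 := by nlinarith [sq_nonneg (gg p i)]
        simpa [gg] using this
      have h5 : ∀ i, max (p i).1 0 ^ 2 = 1 := by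
        intro i
        have := hp i
        simp only [II, const_wev (hg0 i), intervalIntegral.integral_const] at this
        norm_num at this
        nlinarith [sq_nonneg (max (p i).1 0)]
      have h6 : mm B p = B := by
        funext i j
        simp [mm, II, const_wev (hg0 _), h5]
      have hc : c ≠ 0 := by
        rintro rfl
        have := hB.neg
        simp [qf] at this
      have := hpd c hc
      rw [h6] at this
      linarith [hB.neg]
    refine ⟨i, fun h0 => ?_⟩
    obtain ⟨x, _, hx⟩ := exists_wev_pos (hp0 i).ne'
    have h1 := congrFun h0 x
    have h2 := hV2 i x
    simp only [Pi.zero_apply] at h1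
    rw [h1] at h2
    have := mul_pos hi hx
    simp at h2
    rcases h2 with h | h <;> simp [h] at this
end deriv1

end part6

section part7
section red

lemma lift_ode {N n : ℕ} (hN : 1 ≤ N) (B : Matrix (Fin n) (Fin n) ℝ) (W W' : Fin n → ℝ → ℝ)
    (h1 : ∀ i x, HasDerivAt (W i) (W' i x) x)
    (h2 : ∀ i x, HasDerivAt (W' i) (-∑ j, B i j * W j x ^ 2 * W i x) x)
    (h3 : ∀ i x, 0 ≤ W i x) (h4 : ∃ i, W i ≠ 0) :
    ∃ u : Fin n → (Fin N → ℝ) → ℝ,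
      (∀ i, ContDiff ℝ 2 (u i)) ∧
      (∀ i x, 0 ≤ u i x) ∧
      (∀ i x, -laplacian (u i) x = ∑ j, B i j * (u j x) ^ 2 * u i x) ∧
      (∃ i, u i ≠ 0) := by
  set i0 : Fin N := ⟨0, hN⟩
  have hW : ∀ i, Continuous (W i) := fun i => continuous_iff_continuousAt.2 fun x => (h1 i x).continuousAt
  have hWd : ∀ i, deriv (W i) = W' i := fun i => funext fun x => (h1 i x).deriv
  have hWd' : ∀ i, deriv (W' i) = fun x => -∑ j, B i j * W j x ^ 2 * W i x :=
    fun i => funext fun x => (h2 i x).deriv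
  have hC : ∀ i, ContDiff ℝ 2 (W i) := by
    intro i
    have e : (2 : WithTop ℕ∞) = 1 + 1 := by norm_num
    rw [e, contDiff_succ_iff_deriv]
    refine ⟨fun x => (h1 i x).differentiableAt, by simp, ?_⟩
    rw [hWd, contDiff_one_iff_deriv, hWd']
    refine ⟨fun x => (h2 i x).differentiableAt, ?_⟩
    fun_prop
  have hfd : ∀ (f f' : ℝ → ℝ), (∀ x, HasDerivAt f (f' x) x) → ∀ (y v : Fin N → ℝ),
      fderiv ℝ (fun y : Fin N → ℝ => f (y i0)) y v = f' (y i0) * v i0 := by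
    intro f f' hf y v
    have hp : HasFDerivAt (fun y : Fin N → ℝ => y i0)
        (ContinuousLinearMap.proj (R := ℝ) (φ := fun _ : Fin N => ℝ) i0) y :=
      (ContinuousLinearMap.proj (R := ℝ) (φ := fun _ : Fin N => ℝ) i0).hasFDerivAt
    have := (hf (y i0)).comp_hasFDerivAt y hp
    have h := this.fderiv
    simp only [Function.comp_def] at h
    rw [h]
    simp
  refine ⟨fun i x => W i (x i0), fun i => ?_, fun i x => h3 _ _, fun i x => ?_, ?_⟩
  · exact (hC i).comp (contDiff_apply ℝ ℝ i0)
  · unfold laplacian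
    rw [Finset.sum_eq_single i0]
    · simp only [hfd _ _ (h1 i), Pi.single_eq_same, mul_one, hfd _ _ (h2 i)]
      ring
    · intro k _ hk
      simp [hfd _ _ (h1 i), Pi.single_eq_of_ne hk.symm]
    · simp
  · obtain ⟨i, hi⟩ := h4
    refine ⟨i, fun h => hi (funext fun x => ?_)⟩
    exact congrFun h (fun _ => x)

lemma sum_sub {n : ℕ} (S : Finset (Fin n)) (f : Fin n → ℝ) (hf : ∀ i, i ∉ S → f i = 0) :
    ∑ i, f i = ∑ i : S, f i := by
  rw [Finset.sum_coe_sort S f]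
  exact (Finset.sum_subset (Finset.subset_univ S) (fun i _ hi => hf i hi)).symm

lemma qf_sub {n : ℕ} (B : Fin n → Fin n → ℝ) (S : Finset (Fin n)) (d : Fin n → ℝ)
    (hd : ∀ i, i ∉ S → d i = 0) :
    qf B d = qf (fun i j : S => B i j) (fun i : S => d i) := by
  unfold qf
  rw [sum_sub S _ (fun i hi => by simp [hd i hi])]
  refine Finset.sum_congr rfl fun i _ => ?_
  rw [sum_sub S _ (fun j hj => by simp [hd j hj])]

theorem existence {N n : ℕ} (hN : 1 ≤ N) (B : Matrix (Fin n) (Fin n) ℝ) (hsym : B.IsSymm)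
    (hdiag : ∀ i, 0 ≤ B i i)
    (hnc : ¬ (∀ c : Fin n → ℝ, (∀ i, 0 ≤ c i) → c ≠ 0 → 0 < ∑ i, ∑ j, B i j * c i * c j)) :
    ∃ u : Fin n → (Fin N → ℝ) → ℝ,
      (∀ i, ContDiff ℝ 2 (u i)) ∧
      (∀ i x, 0 ≤ u i x) ∧
      (∀ i x, -laplacian (u i) x = ∑ j, B i j * (u j x) ^ 2 * u i x) ∧
      (∃ i, u i ≠ 0) := by
  classical
  have hs : ∀ i j, B i j = B j i := fun i j => hsym.apply j i
  push Not at hnc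
  obtain ⟨c0, hc00, hc0n, hc0q⟩ := hnc
  let Q : Finset (Fin n) → Prop := fun S => ∃ c : Fin n → ℝ, (∀ i, 0 ≤ c i) ∧ c ≠ 0 ∧
    (∀ i, i ∉ S → c i = 0) ∧ qf B c ≤ 0
  obtain ⟨S, hS, hmin⟩ := exists_minimal_of_wellFoundedLT Q ⟨Finset.univ, c0, hc00, hc0n, by simp, hc0q⟩
  have H2 : ∀ d : Fin n → ℝ, (∀ i, 0 ≤ d i) → d ≠ 0 → (∀ i, i ∉ S → d i = 0) →
      (∃ i ∈ S, d i = 0) → 0 < qf B d := by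
    rintro d hd0 hdn hdS ⟨i, hiS, hi⟩
    by_contra! hcon
    have : S ⊆ S.erase i := hmin (y := S.erase i) ⟨d, hd0, hdn, fun k hk => by
      by_cases h : k = i
      · rw [h, hi]
      · exact hdS k fun hkS => hk (Finset.mem_erase.2 ⟨h, hkS⟩), hcon⟩ (Finset.erase_subset _ _)
    exact (Finset.notMem_erase i S) (this hiS)
  by_cases hA : ∀ d : Fin n → ℝ, (∀ i, 0 ≤ d i) → (∀ i, i ∉ S → d i = 0) → 0 ≤ qf B d
  · obtain ⟨c, hc0, hcn, hcS, hcq⟩ := hS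
    have hcq0 : qf B c = 0 := le_antisymm hcq (hA c hc0 hcS)
    have hb : ∀ i, 0 < c i → ∑ j, B i j * c j = 0 := by
      intro i hi
      have hiS : i ∈ S := by
        by_contra h; rw [hcS i h] at hi; exact lt_irrefl _ hi
      have hq : ∀ t : ℝ, -c i ≤ t → 0 ≤ 2 * t * (∑ j, B i j * c j) + t ^ 2 * B i i := by
        intro t ht
        have h := hA (c + t • Pi.single i 1) (fun k => by
          by_cases hk : k = i
          · subst hk; simp; linarith
          · simp [Pi.single_eq_of_ne hk, hc0 k]) (fun k hk => by
          have hki : k ≠ i := fun h => hk (h ▸ hiS)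
          simp [Pi.single_eq_of_ne hki, hcS k hk])
        rw [qf_add_smul B hs, hcq0] at h
        have e1 : ∑ k, ∑ j, B k j * c k * (Pi.single i (1:ℝ) : Fin n → ℝ) j = ∑ j, B i j * c j := by
          refine Finset.sum_congr rfl fun k _ => ?_
          rw [Finset.sum_eq_single i (by intro j _ hj; simp [Pi.single_eq_of_ne hj]) (by simp)]
          rw [hs k i]; simp
        have e2 : qf B (Pi.single i (1:ℝ) : Fin n → ℝ) = B i i := by
          unfold qf
          rw [Finset.sum_eq_single i (by intro j _ hj; simp [Pi.single_eq_of_ne hj]) (by simp),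
            Finset.sum_eq_single i (by intro j _ hj; simp [Pi.single_eq_of_ne hj]) (by simp)]
          simp
        rw [e1, e2] at h
        linarith
      set b := ∑ j, B i j * c j
      have hBi := hdiag i
      rcases lt_trichotomy b 0 with h | h | h
      · exfalso
        have h1 := hq (-b / (B i i + 1)) (by
          have : 0 ≤ -b / (B i i + 1) := div_nonneg (by linarith) (by linarith)
          linarith)
        set s := -b / (B i i + 1) with hsd
        have hs1 : s * (B i i + 1) = -b := by rw [hsd]; field_simp
        have hsp : 0 < s := div_pos (by linarith) (by linarith)
        nlinarith
      · exact h
      · exfalso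
        set s := min (c i) (b / (B i i + 1)) with hsd
        have hsp : 0 < s := lt_min hi (div_pos h (by linarith))
        have h1 := hq (-s) (by have := min_le_left (c i) (b / (B i i + 1)); linarith)
        have hs1 : s * (B i i + 1) ≤ b := by
          rw [← le_div_iff₀ (by linarith)]; exact min_le_right _ _
        nlinarith
    refine lift_ode hN B (fun i _ => Real.sqrt (c i)) (fun _ _ => 0) (fun i x => hasDerivAt_const _ _)
      (fun i x => ?_) (fun i x => Real.sqrt_nonneg _) ?_
    · have : ∑ j, B i j * Real.sqrt (c j) ^ 2 * Real.sqrt (c i) = 0 := by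
        simp only [Real.sq_sqrt (hc0 _)]
        rw [← Finset.sum_mul]
        rcases (hc0 i).lt_or_eq with h | h
        · rw [hb i h, zero_mul]
        · simp [← h]
      rw [this, neg_zero]
      exact hasDerivAt_const _ _
    · obtain ⟨i, hi⟩ := Function.ne_iff.1 hcn
      refine ⟨i, fun h => ?_⟩
      have := congrFun h 0
      simp only [Pi.zero_apply] at this
      rw [Real.sqrt_eq_zero (hc0 i)] at this
      exact hi this
  · push Not at hA
    obtain ⟨d, hd0, hdS, hdq⟩ := hA
    have hext : ∀ e : S → ℝ, qf (fun i j : S => B i j) e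
        = qf B (fun i => if h : i ∈ S then e ⟨i, h⟩ else 0) := by
      intro e
      rw [qf_sub B S _ (fun i hi => by simp [hi])]
      congr 1; funext i; simp
    have hHB : HB (fun i j : S => B i j) (fun i : S => d i) := by
      refine ⟨fun i j => hs _ _, fun i => hd0 _, ?_, ?_, ?_⟩
      · rw [← qf_sub B S d hdS]; exact hdq
      · rintro e he0 hen ⟨i, hi⟩
        rw [hext]
        refine H2 _ (fun k => ?_) (fun h => hen ?_) (fun k hk => by simp [hk]) ⟨i, i.2, by simp [hi]⟩
        · split_ifs
          · exact he0 _
          · exact le_rfl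
        · funext k
          have := congrFun h k
          simpa using this
      · intro i
        by_cases hex : ∃ k ∈ S, k ≠ (i : Fin n)
        · obtain ⟨k, hkS, hk⟩ := hex
          have := H2 (Pi.single (i : Fin n) 1) (fun k => by
            by_cases hk : k = i
            · subst hk; simp
            · simp [Pi.single_eq_of_ne hk]) (by simp) (fun k hk => by
            have : k ≠ i := fun h => hk (h ▸ i.2)
            simp [Pi.single_eq_of_ne this]) ⟨k, hkS, by simp [Pi.single_eq_of_ne hk]⟩
          unfold qf at this
          rw [Finset.sum_eq_single (i : Fin n) (by intro j _ hj; simp [Pi.single_eq_of_ne hj]) (by simp),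
            Finset.sum_eq_single (i : Fin n) (by intro j _ hj; simp [Pi.single_eq_of_ne hj]) (by simp)] at this
          simpa using this
        · exfalso
          push Not at hex
          have hz : ∀ k, k ≠ (i : Fin n) → d k = 0 := fun k hk => hdS k fun h => hk (hex k h)
          unfold qf at hdq
          rw [Finset.sum_eq_single (i : Fin n) (by intro j _ hj; simp [hz j hj]) (by simp),
            Finset.sum_eq_single (i : Fin n) (by intro j _ hj; simp [hz j hj]) (by simp)] at hdq
          have := hdiag i
          nlinarith [mul_self_nonneg (d i), mul_nonneg this (mul_self_nonneg (d i))]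
    obtain ⟨V, V', hV1, hV2, hV3, i1, hV4⟩ := exists_ode hHB
    refine lift_ode hN B (fun i x => if h : i ∈ S then V ⟨i, h⟩ x else 0)
      (fun i x => if h : i ∈ S then V' ⟨i, h⟩ x else 0) ?_ ?_ ?_ ⟨i1, ?_⟩
    · intro i x
      by_cases h : i ∈ S
      · simp only [h, dite_true]; exact hV1 _ _
      · simp only [h, dite_false]; exact hasDerivAt_const _ _
    · intro i x
      by_cases h : i ∈ S
      · simp only [h, dite_true]
        rw [sum_sub S _ (fun j hj => by simp [hj])]
        simp only [Finset.coe_mem, dite_true]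
        exact hV2 ⟨i, h⟩ x
      · simp only [h, dite_false, mul_zero, Finset.sum_const_zero, neg_zero]; exact hasDerivAt_const _ _
    · intro i x
      split_ifs
      · exact hV3 _ _
      · exact le_rfl
    · intro h
      apply hV4
      funext x
      have := congrFun h x
      simpa using this
end red

end part7

section part8
section smp
open Filter Topology

lemma fderiv_line {N : ℕ} {f : (Fin N → ℝ) → ℝ} {x v : Fin N → ℝ} {a : ℝ}
    (hf : DifferentiableAt ℝ f x) (h : HasDerivAt (fun t : ℝ => f (x + t • v)) a 0) :
    fderiv ℝ f x v = a := by
  rw [← hf.lineDeriv_eq_fderiv]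
  exact HasLineDerivAt.lineDeriv h

lemma contDiff_pd {N : ℕ} {f : (Fin N → ℝ) → ℝ} (hf : ContDiff ℝ 2 f) (v : Fin N → ℝ) :
    ContDiff ℝ 1 (fun y => fderiv ℝ f y v) :=
  (hf.fderiv_right (m := 1) (by norm_num)).clm_apply contDiff_const

lemma hasDerivAt_line {N : ℕ} {f : (Fin N → ℝ) → ℝ} (hf : Differentiable ℝ f) (x v : Fin N → ℝ) (t : ℝ) :
    HasDerivAt (fun t : ℝ => f (x + t • v)) (fderiv ℝ f (x + t • v) v) t := by
  have h1 : HasDerivAt (fun t : ℝ => x + t • v) v t := by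
    simpa using ((hasDerivAt_id t).smul_const v).const_add x
  exact (hf (x + t • v)).hasFDerivAt.comp_hasDerivAt t h1

lemma second_deriv_nonneg {f f' : ℝ → ℝ} {a : ℝ} (hf : ∀ t, HasDerivAt f (f' t) t)
    (hf' : HasDerivAt f' a 0) (hm : IsLocalMin f 0) : 0 ≤ a := by
  by_contra! ha
  have hd : deriv f = f' := funext fun t => (hf t).deriv
  have hd2 : deriv (deriv f) 0 = a := by rw [hd]; exact hf'.deriv
  have hmax : IsLocalMax f 0 := by
    have := isLocalMin_of_deriv_deriv_pos (f := fun t => -f t) (x₀ := 0)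
      (by simp only [deriv.fun_neg']; rw [hd2]; linarith)
      (by rw [deriv.fun_neg, hm.deriv_eq_zero, neg_zero]) (hf 0).continuousAt.neg
    simpa using this.neg
  have hc : f =ᶠ[𝓝 0] fun _ => f 0 := by
    filter_upwards [hm, hmax] with t h1 h2
    exact le_antisymm h2 h1
  have h1 : deriv f =ᶠ[𝓝 0] deriv (fun _ => f 0) := hc.deriv
  have h2 := h1.deriv_eq
  simp only [deriv_const'] at h2
  rw [hd2] at h2
  linarith

lemma laplacian_nonneg {N : ℕ} {f : (Fin N → ℝ) → ℝ} (hf : ContDiff ℝ 2 f) {x : Fin N → ℝ}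
    (hm : IsLocalMin f x) : 0 ≤ laplacian f x := by
  unfold laplacian
  refine Finset.sum_nonneg fun i _ => ?_
  set v : Fin N → ℝ := Pi.single i 1
  have hline : Tendsto (fun t : ℝ => x + t • v) (𝓝 0) (𝓝 x) := by
    have : Continuous (fun t : ℝ => x + t • v) := by fun_prop
    simpa using this.tendsto 0
  refine second_deriv_nonneg (f := fun t => f (x + t • v)) (f' := fun t => fderiv ℝ f (x + t • v) v)
    (fun t => hasDerivAt_line (hf.differentiable (by norm_num)) x v t) ?_ ?_
  · have := hasDerivAt_line ((contDiff_pd hf v).differentiable (by norm_num)) x v 0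
    simpa using this
  · have := hline.eventually hm
    simpa [IsLocalMin, IsMinFilter] using this

lemma laplacian_sub_mul {N : ℕ} {f g : (Fin N → ℝ) → ℝ} (hf : ContDiff ℝ 2 f) (hg : ContDiff ℝ 2 g)
    (c : ℝ) (x : Fin N → ℝ) :
    laplacian (fun y => f y - c * g y) x = laplacian f x - c * laplacian g x := by
  unfold laplacian
  rw [Finset.mul_sum, ← Finset.sum_sub_distrib]
  refine Finset.sum_congr rfl fun i _ => ?_
  have key : ∀ (F G : (Fin N → ℝ) → ℝ), Differentiable ℝ F → Differentiable ℝ G → ∀ y v,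
      fderiv ℝ (fun y => F y - c * G y) y v = fderiv ℝ F y v - c * fderiv ℝ G y v := by
    intro F G hF hG y v
    have := ((hF y).hasFDerivAt.sub ((hG y).hasFDerivAt.const_mul c)).fderiv
    have h2 : fderiv ℝ (fun y => F y - c * G y) y = fderiv ℝ F y - c • fderiv ℝ G y := this
    rw [h2]; simp
  have e : (fun y => fderiv ℝ (fun y => f y - c * g y) y (Pi.single i 1)) =
      fun y => fderiv ℝ f y (Pi.single i 1) - c * fderiv ℝ g y (Pi.single i 1) := by
    funext y
    exact key f g (hf.differentiable (by norm_num)) (hg.differentiable (by norm_num)) y _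
  rw [e]
  exact key _ _ ((contDiff_pd hf _).differentiable (by norm_num))
    ((contDiff_pd hg _).differentiable (by norm_num)) x _

noncomputable def qd {N : ℕ} (y x : Fin N → ℝ) : ℝ := ∑ i, (x i - y i) ^ 2

lemma contDiff_qd {N : ℕ} (y : Fin N → ℝ) : ContDiff ℝ 2 (qd y) := by
  unfold qd
  fun_prop

lemma qd_line {N : ℕ} (y x : Fin N → ℝ) (i : Fin N) (t : ℝ) :
    qd y (x + t • Pi.single i 1) = qd y x + 2 * t * (x i - y i) + t ^ 2 := by
  unfold qd
  have : ∀ k, ((x + t • (Pi.single i (1:ℝ) : Fin N → ℝ)) k - y k) ^ 2 =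
      (x k - y k) ^ 2 + if k = i then 2 * t * (x k - y k) + t ^ 2 else 0 := by
    intro k
    by_cases hk : k = i
    · subst hk; simp; ring
    · simp [Pi.single_eq_of_ne hk, hk]
  simp only [this, Finset.sum_add_distrib, Finset.sum_ite_eq', Finset.mem_univ, if_true]
  ring

noncomputable def bar {N : ℕ} (α r : ℝ) (y x : Fin N → ℝ) : ℝ := Real.exp (-α * qd y x) - r

lemma contDiff_bar {N : ℕ} (α r : ℝ) (y : Fin N → ℝ) : ContDiff ℝ 2 (bar α r y) := by
  unfold bar
  have := contDiff_qd y
  fun_prop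

lemma laplacian_bar {N : ℕ} (α r : ℝ) (y x : Fin N → ℝ) :
    laplacian (bar α r y) x = (4 * α ^ 2 * qd y x - 2 * N * α) * Real.exp (-α * qd y x) := by
  unfold laplacian
  have hq : ∀ (x : Fin N → ℝ) i, HasDerivAt (fun t : ℝ => Real.exp (-α * qd y (x + t • Pi.single i 1)))
      (Real.exp (-α * qd y x) * (-α * (2 * (x i - y i)))) 0 := by
    intro x i
    simp only [qd_line]
    have h1 : HasDerivAt (fun t : ℝ => -α * (qd y x + 2 * t * (x i - y i) + t ^ 2))
        (-α * (2 * (x i - y i))) 0 := by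
      have := (((((hasDerivAt_id (0:ℝ)).const_mul 2).mul_const (x i - y i)).const_add (qd y x)).add
        (hasDerivAt_pow 2 (0:ℝ))).const_mul (-α)
      refine this.congr_deriv ?_
      simp
    have := h1.exp
    simpa using this
  have h1 : ∀ i, (fun x => fderiv ℝ (bar α r y) x (Pi.single i 1)) =
      fun x => Real.exp (-α * qd y x) * (-α * (2 * (x i - y i))) := by
    intro i
    funext x
    refine fderiv_line ((contDiff_bar α r y).differentiable (by norm_num) x) ?_
    exact (hq x i).sub_const r
  have h2 : ∀ i, fderiv ℝ (fun x => Real.exp (-α * qd y x) * (-α * (2 * (x i - y i)))) x (Pi.single i 1)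
      = (4 * α ^ 2 * (x i - y i) ^ 2 - 2 * α) * Real.exp (-α * qd y x) := by
    intro i
    refine fderiv_line ?_ ?_
    · have h3 := contDiff_qd y
      have : ContDiff ℝ 2 (fun x : Fin N → ℝ => Real.exp (-α * qd y x) * (-α * (2 * (x i - y i)))) := by
        fun_prop
      exact this.differentiable (by norm_num) x
    · have h4 : HasDerivAt (fun t : ℝ => -α * (2 * ((x + t • (Pi.single i (1:ℝ) : Fin N → ℝ)) i - y i)))
          (-α * 2) 0 := by
        simp only [Pi.add_apply, Pi.smul_apply, Pi.single_eq_same, smul_eq_mul, mul_one]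
        have := ((((hasDerivAt_id (0:ℝ)).const_add (x i)).sub_const (y i)).const_mul 2).const_mul (-α)
        refine this.congr_deriv ?_
        simp
      refine ((hq x i).mul h4).congr_deriv ?_
      simp
      ring
  simp only [h1, h2]
  rw [← Finset.sum_mul, Finset.sum_sub_distrib, ← Finset.mul_sum]
  simp [qd]
  ring

lemma isCompact_qd {N : ℕ} (y : Fin N → ℝ) (R : ℝ) : IsCompact {x | qd y x ≤ R} := by
  refine Metric.isCompact_of_isClosed_isBounded
    (isClosed_le (contDiff_qd y).continuous continuous_const) ?_
  refine (Metric.isBounded_closedBall (x := y) (r := R + 1)).subset fun x hx => ?_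
  have hx' : qd y x ≤ R := hx
  have hqn : 0 ≤ qd y x := Finset.sum_nonneg fun i _ => sq_nonneg _
  rw [Metric.mem_closedBall, dist_pi_le_iff (by linarith)]
  intro i
  have h1 : (x i - y i) ^ 2 ≤ qd y x :=
    Finset.single_le_sum (f := fun i => (x i - y i) ^ 2) (fun i _ => sq_nonneg _) (Finset.mem_univ i)
  rw [Real.dist_eq]
  apply abs_le_of_sq_le_sq
  · nlinarith
  · linarith

lemma strong_max {N : ℕ} {u V : (Fin N → ℝ) → ℝ} (hu : ContDiff ℝ 2 u) (h0 : ∀ x, 0 ≤ u x)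
    (hV : Continuous V) (heq : ∀ x, -laplacian u x = V x * u x) (y : Fin N → ℝ) (hy : 0 < u y)
    (z : Fin N → ℝ) : 0 < u z := by
  have hqn : ∀ x, 0 ≤ qd y x := fun x => Finset.sum_nonneg fun i _ => sq_nonneg _
  have hqc : Continuous (qd y) := (contDiff_qd y).continuous
  have hqy : qd y y = 0 := by simp [qd]
  -- small ball
  obtain ⟨ρ, hρ, m, hm, hsm⟩ : ∃ ρ > 0, ∃ m > 0, ∀ x, qd y x ≤ ρ → m ≤ u x := by
    have hcl : ∃ ρ > 0, ∀ x, qd y x ≤ ρ → u y / 2 < u x := by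
      by_contra! hcon
      have h1 : ∀ k : ℕ, ∃ x, qd y x ≤ 1 / ((k:ℝ) + 1) ∧ u x ≤ u y / 2 := fun k =>
        hcon _ (by positivity)
      choose x hx1 hx2 using h1
      have hxt : Tendsto x atTop (𝓝 y) := by
        rw [tendsto_pi_nhds]
        intro i
        have h2 : ∀ k, (x k i - y i) ^ 2 ≤ 1 / ((k:ℝ) + 1) := fun k =>
          (Finset.single_le_sum (f := fun i => (x k i - y i) ^ 2) (fun i _ => sq_nonneg _)
            (Finset.mem_univ i)).trans (hx1 k)
        have h3 : Tendsto (fun k => (x k i - y i) ^ 2) atTop (𝓝 0) :=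
          squeeze_zero (fun k => sq_nonneg _) h2 tendsto_one_div_add_atTop_nhds_zero_nat
        have h4 := h3.sqrt
        simp only [Real.sqrt_sq_eq_abs, Real.sqrt_zero] at h4
        have h5 := (tendsto_zero_iff_abs_tendsto_zero _).2 h4
        simpa using h5.add_const (y i)
      have h6 := le_of_tendsto' (hu.continuous.continuousAt.tendsto.comp hxt) hx2
      linarith
    obtain ⟨ρ, hρ, h⟩ := hcl
    exact ⟨ρ, hρ, u y / 2, by linarith, fun x hx => (h x hx).le⟩
  set R := qd y z + 1 with hR
  -- bound for V
  obtain ⟨K, hK⟩ := (isCompact_qd y R).exists_bound_of_continuousOn hV.continuousOn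
  have hK0 : 0 ≤ K := (norm_nonneg _).trans (hK y (by show qd y y ≤ R; rw [hqy]; linarith [hqn z]))
  obtain ⟨α, hα, hα2⟩ : ∃ α > 0, K < 4 * α ^ 2 * ρ - 2 * N * α := by
    refine ⟨(2 * N + K + 1) / (4 * ρ) + 1, by positivity, ?_⟩
    set a := (2 * N + K + 1) / (4 * ρ) with ha
    have h1 : a * (4 * ρ) = 2 * N + K + 1 := by rw [ha]; field_simp
    have h2 : 0 ≤ a := by positivity
    have h3 : 4 * (a + 1) ^ 2 * ρ = (a + 1) * (a * (4 * ρ)) + (a + 1) * (4 * ρ) := by ring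
    rw [h3, h1]
    nlinarith [mul_nonneg h2 hK0, mul_nonneg h2 hρ.le]
  set r := Real.exp (-α * R) with hr
  set w : (Fin N → ℝ) → ℝ := fun x => u x - m * bar α r y x with hw
  have hwc : ContDiff ℝ 2 w := hu.sub (contDiff_const.mul (contDiff_bar α r y))
  have hb1 : ∀ x, bar α r y x ≤ 1 := by
    intro x
    unfold bar
    have : Real.exp (-α * qd y x) ≤ 1 := Real.exp_le_one_iff.2 (by nlinarith [hqn x])
    have := Real.exp_pos (-α * R)
    linarith
  have hmain : ∀ x, qd y x ≤ R → 0 ≤ w x := by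
    obtain ⟨x0, hx0, hmin⟩ := (isCompact_qd y R).exists_isMinOn
      ⟨y, by show qd y y ≤ R; rw [hqy]; linarith [hqn z]⟩ hwc.continuous.continuousOn
    suffices h : 0 ≤ w x0 from fun x hx => h.trans (hmin hx)
    by_contra! hneg
    have hx0' : qd y x0 ≤ R := hx0
    have c1 : ρ < qd y x0 := by
      by_contra! hc
      have h1 := hsm x0 hc
      have h2 := hb1 x0
      have h3 : w x0 = u x0 - m * bar α r y x0 := rfl
      nlinarith
    have c2 : qd y x0 < R := by
      refine lt_of_le_of_ne hx0' fun hc => ?_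
      have h3 : w x0 = u x0 - m * bar α r y x0 := rfl
      have h4 : bar α r y x0 = 0 := by unfold bar; rw [hc, hr]; ring
      rw [h4] at h3
      linarith [h0 x0]
    have hloc : IsLocalMin w x0 := by
      have : {x | qd y x < R} ∈ 𝓝 x0 := (isOpen_lt hqc continuous_const).mem_nhds c2
      filter_upwards [this] with x hx
      exact hmin (show qd y x ≤ R from le_of_lt hx)
    have hL := laplacian_nonneg hwc hloc
    rw [hw, laplacian_sub_mul hu (contDiff_bar α r y), laplacian_bar] at hL
    have hVx := (abs_le.1 (hK x0 hx0)).1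
    have hlu : laplacian u x0 ≤ K * u x0 := by
      have := heq x0
      nlinarith [h0 x0]
    have he := Real.exp_pos (-α * qd y x0)
    have hr0 : 0 < r := Real.exp_pos _
    have hw0 : u x0 - m * (Real.exp (-α * qd y x0) - r) < 0 := hneg
    have h5 : K * Real.exp (-α * qd y x0) <
        (4 * α ^ 2 * qd y x0 - 2 * N * α) * Real.exp (-α * qd y x0) := by
      apply mul_lt_mul_of_pos_right _ he
      have : 4 * α ^ 2 * ρ ≤ 4 * α ^ 2 * qd y x0 := by gcongr
      linarith
    have h6 := mul_lt_mul_of_pos_left h5 hm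
    have h7 : K * (u x0 - m * (Real.exp (-α * qd y x0) - r)) ≤ 0 :=
      mul_nonpos_of_nonneg_of_nonpos hK0 hw0.le
    have h8 : 0 ≤ K * m * r := by positivity
    nlinarith
  have hz := hmain z (by linarith)
  have hbz : 0 < bar α r y z := by
    unfold bar
    rw [sub_pos, hr]
    apply Real.exp_lt_exp.2
    rw [hR]; linarith
  have : w z = u z - m * bar α r y z := rfl
  have h9 := mul_pos hm hbz
  linarith
end smp

end part8

section part9
section liou
open Filter Topology MeasureTheory

lemma log_test {N : ℕ} {u φ : (Fin N → ℝ) → ℝ} (hu : ContDiff ℝ 2 u) (hpos : ∀ x, 0 < u x)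
    (hφ : ContDiff ℝ 1 φ) (hs : HasCompactSupport φ) (v : Fin N → ℝ) :
    -∫ x, φ x ^ 2 / u x * fderiv ℝ (fun y => fderiv ℝ u y v) x v ≤ ∫ x, (fderiv ℝ φ x v) ^ 2 := by
  have hcs : ∀ F : (Fin N → ℝ) → ℝ, (∀ x, φ x = 0 → F x = 0) → HasCompactSupport F := fun F h =>
    hs.mono fun x hx h0 => hx (h x h0)
  have hg := contDiff_pd hu v
  have hu1 : ContDiff ℝ 1 u := hu.of_le (by norm_num)
  have hf : ContDiff ℝ 1 (fun x => φ x ^ 2 / u x) := (hφ.pow 2).div hu1 fun x => (hpos x).ne'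
  have hg' : Continuous (fun x => fderiv ℝ (fun y => fderiv ℝ u y v) x v) :=
    (hg.continuous_fderiv (by norm_num)).clm_apply continuous_const
  have hf' : Continuous (fun x => fderiv ℝ (fun x => φ x ^ 2 / u x) x v) :=
    (hf.continuous_fderiv (by norm_num)).clm_apply continuous_const
  have hφ' : Continuous (fun x => fderiv ℝ φ x v) :=
    (hφ.continuous_fderiv (by norm_num)).clm_apply continuous_const
  have hfs : HasCompactSupport (fun x => φ x ^ 2 / u x) := hcs _ fun x hx => by simp [hx]
  have i1 : Integrable (fun x => fderiv ℝ (fun x => φ x ^ 2 / u x) x v * fderiv ℝ u x v) := by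
    refine (hf'.mul hg.continuous).integrable_of_hasCompactSupport ?_
    exact (hfs.fderiv_apply (𝕜 := ℝ) v).mul_right
  have i2 : Integrable (fun x => φ x ^ 2 / u x * fderiv ℝ (fun y => fderiv ℝ u y v) x v) :=
    (hf.continuous.mul hg').integrable_of_hasCompactSupport hfs.mul_right
  have i3 : Integrable (fun x => φ x ^ 2 / u x * fderiv ℝ u x v) :=
    (hf.continuous.mul hg.continuous).integrable_of_hasCompactSupport hfs.mul_right
  rw [integral_mul_fderiv_eq_neg_fderiv_mul_of_integrable i1 i2 i3
    (fun x _ => hf.differentiable (by norm_num) x) (fun x _ => hg.differentiable (by norm_num) x), neg_neg]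
  refine integral_mono i1 ?_ fun x => ?_
  · have h1 : HasCompactSupport (fun x => fderiv ℝ φ x v) := hs.fderiv_apply (𝕜 := ℝ) v
    have h2 : HasCompactSupport (fun x => (fderiv ℝ φ x v) ^ 2) :=
      h1.mono fun x hx h0 => hx (by simp only [h0]; norm_num)
    have h3 : Continuous (fun x => (fderiv ℝ φ x v) ^ 2) := hφ'.pow 2
    exact h3.integrable_of_hasCompactSupport h2
  · have hd : fderiv ℝ (fun x => φ x ^ 2 / u x) x v
        = (2 * φ x * fderiv ℝ φ x v * u x - φ x ^ 2 * fderiv ℝ u x v) / u x ^ 2 := by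
      have a1 := hasDerivAt_line (hφ.differentiable (by norm_num)) x v 0
      have a2 := hasDerivAt_line (hu1.differentiable (by norm_num)) x v 0
      refine fderiv_line (hf.differentiable (by norm_num) x) ?_
      refine ((a1.pow 2).div a2 (hpos _).ne').congr_deriv ?_
      simp
    simp only
    rw [hd]
    have hux := hpos x
    set a := fderiv ℝ φ x v
    set b := fderiv ℝ u x v
    have : (2 * φ x * a * u x - φ x ^ 2 * b) / u x ^ 2 * b = a ^ 2 - (a - φ x * b / u x) ^ 2 := by
      field_simp; ring
    rw [this]
    nlinarith [sq_nonneg (a - φ x * b / u x)]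

lemma log_test_sum {N : ℕ} {u V φ : (Fin N → ℝ) → ℝ} (hu : ContDiff ℝ 2 u) (hpos : ∀ x, 0 < u x)
    (heq : ∀ x, -laplacian u x = V x * u x)
    (hφ : ContDiff ℝ 1 φ) (hs : HasCompactSupport φ) :
    ∫ x, φ x ^ 2 * V x ≤ ∑ i : Fin N, ∫ x, (fderiv ℝ φ x (Pi.single i 1)) ^ 2 := by
  have hf : ContDiff ℝ 1 (fun x => φ x ^ 2 / u x) :=
    (hφ.pow 2).div (hu.of_le (by norm_num)) fun x => (hpos x).ne'
  have hfs : HasCompactSupport (fun x => φ x ^ 2 / u x) :=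
    hs.mono fun x hx h0 => hx (by simp [h0])
  have e : ∫ x, φ x ^ 2 * V x = ∑ i : Fin N, -∫ x, φ x ^ 2 / u x *
      fderiv ℝ (fun y => fderiv ℝ u y (Pi.single i 1)) x (Pi.single i 1) := by
    rw [Finset.sum_neg_distrib, ← integral_finsetSum, ← integral_neg]
    · refine integral_congr_ae (Eventually.of_forall fun x => ?_)
      simp only
      rw [← Finset.mul_sum]
      have h1 : V x * u x = -∑ i : Fin N,
          fderiv ℝ (fun y => fderiv ℝ u y (Pi.single i 1)) x (Pi.single i 1) := (heq x).symm
      have h2 := (hpos x).ne'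
      have h3 : V x = (V x * u x) / u x := by field_simp
      rw [h3, h1]
      ring
    · intro i _
      have hg' : Continuous (fun x => fderiv ℝ (fun y => fderiv ℝ u y (Pi.single i 1)) x (Pi.single i 1)) :=
        ((contDiff_pd hu _).continuous_fderiv (by norm_num)).clm_apply continuous_const
      exact (hf.continuous.mul hg').integrable_of_hasCompactSupport hfs.mul_right
  rw [e]
  exact Finset.sum_le_sum fun i _ => log_test hu hpos hφ hs _

lemma cutoff {N : ℕ} (hN : N ≤ 2) (η : ℝ) (hη : 0 < η) :
    ∃ φ : (Fin N → ℝ) → ℝ, ContDiff ℝ 1 φ ∧ HasCompactSupport φ ∧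
      (∀ x ∈ Metric.closedBall (0 : Fin N → ℝ) 1, φ x = 1) ∧
      ∑ i : Fin N, ∫ x, (fderiv ℝ φ x (Pi.single i 1)) ^ 2 ≤ η := by
  let χ : ContDiffBump (0 : Fin N → ℝ) := ⟨1, 2, one_pos, one_lt_two⟩
  have hχ : ContDiff ℝ 1 χ := χ.contDiff
  have hχd : Differentiable ℝ χ := hχ.differentiable (by norm_num)
  have hχs : HasCompactSupport χ := χ.hasCompactSupport
  have hz1 : ∀ x : Fin N → ℝ, ‖x‖ < 1 → fderiv ℝ χ x = 0 := by
    intro x hx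
    have : χ =ᶠ[𝓝 x] (fun _ => (1:ℝ)) := χ.eventuallyEq_one_of_mem_ball (by simpa using hx)
    rw [this.fderiv_eq]; simp
  have hz2 : ∀ x : Fin N → ℝ, 2 < ‖x‖ → fderiv ℝ χ x = 0 := by
    intro x hx
    have : χ =ᶠ[𝓝 x] (fun _ => (0:ℝ)) := by
      filter_upwards [(isOpen_lt continuous_const continuous_norm).mem_nhds hx] with y hy
      exact χ.zero_of_le_dist (by simpa using le_of_lt hy)
    rw [this.fderiv_eq]; simp
  set C : ℝ := ∑ i : Fin N, ∫ x, (fderiv ℝ χ x (Pi.single i 1)) ^ 2 with hC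
  have hC0 : 0 ≤ C := Finset.sum_nonneg fun i _ => integral_nonneg fun x => sq_nonneg _
  obtain ⟨k, hk⟩ := exists_nat_gt (C / η)
  have hk0 : (0:ℝ) < k := lt_of_le_of_lt (by positivity) hk
  set R : ℕ → ℝ := fun j => 4 ^ j with hR
  have hRp : ∀ j, 0 < R j := fun j => by simp only [hR]; positivity
  have hR1 : ∀ j, 1 ≤ R j := fun j => one_le_pow₀ (by norm_num)
  let ψ : ℕ → (Fin N → ℝ) → ℝ := fun j x => χ ((R j)⁻¹ • x)
  have hψc : ∀ j, ContDiff ℝ 1 (ψ j) := fun j => hχ.comp (contDiff_const_smul _)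
  have hψs : ∀ j, HasCompactSupport (ψ j) := fun j =>
    hχs.comp_smul (inv_ne_zero (hRp j).ne')
  have hψd : ∀ j x v, fderiv ℝ (ψ j) x v = (R j)⁻¹ * fderiv ℝ χ ((R j)⁻¹ • x) v := by
    intro j x v
    refine fderiv_line ((hψc j).differentiable (by norm_num) x) ?_
    have h1 := hasDerivAt_line hχd ((R j)⁻¹ • x) ((R j)⁻¹ • v) 0
    simp only [zero_smul, add_zero, map_smul, smul_eq_mul] at h1
    refine h1.congr_of_eventuallyEq (Eventually.of_forall fun t => ?_)
    simp only [ψ, smul_add, smul_comm t]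
  have hdisj : ∀ j l, j < l → ∀ x v, fderiv ℝ (ψ j) x v * fderiv ℝ (ψ l) x v = 0 := by
    intro j l hjl x v
    rw [hψd, hψd]
    have hn : ∀ j, ‖(R j)⁻¹ • x‖ = (R j)⁻¹ * ‖x‖ := fun j => by
      rw [norm_smul, Real.norm_of_nonneg (inv_nonneg.2 (hRp j).le)]
    rcases lt_or_ge 2 ((R j)⁻¹ * ‖x‖) with h | h
    · rw [hz2 _ (by rw [hn]; exact h)]; simp
    · rw [hz1 ((R l)⁻¹ • x) ?_]
      · simp
      · rw [hn, inv_mul_lt_iff₀ (hRp l), mul_one]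
        rw [inv_mul_le_iff₀ (hRp j)] at h
        have : R (j + 1) ≤ R l := pow_le_pow_right₀ (by norm_num) hjl
        have h4 : R (j + 1) = 4 * R j := by simp only [hR]; ring
        have := hRp j
        linarith
  have hdisj' : ∀ j l, j ≠ l → ∀ x v, fderiv ℝ (ψ j) x v * fderiv ℝ (ψ l) x v = 0 := by
    intro j l hjl x v
    rcases lt_or_gt_of_ne hjl with h | h
    · exact hdisj j l h x v
    · rw [mul_comm]; exact hdisj l j h x v
  have hint : ∀ j v, ∫ x, (fderiv ℝ (ψ j) x v) ^ 2 ≤ ∫ x, (fderiv ℝ χ x v) ^ 2 := by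
    intro j v
    simp only [hψd, mul_pow]
    rw [integral_const_mul, Measure.integral_comp_inv_smul volume (fun x => (fderiv ℝ χ x v) ^ 2) (R j)]
    have h0 : 0 ≤ ∫ x, (fderiv ℝ χ x v) ^ 2 := integral_nonneg fun x => sq_nonneg _
    rw [smul_eq_mul, ← mul_assoc]
    refine mul_le_of_le_one_left h0 ?_
    have hfr : Module.finrank ℝ (Fin N → ℝ) = N := by simp
    rw [hfr, abs_of_nonneg (pow_nonneg (hRp j).le _), inv_pow, inv_mul_le_iff₀ (by have := hRp j; positivity),
      mul_one]
    exact pow_le_pow_right₀ (hR1 j) hN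
  have hdc : ∀ j v, Continuous (fun x => fderiv ℝ (ψ j) x v) := fun j v =>
    ((hψc j).continuous_fderiv (by norm_num)).clm_apply continuous_const
  have hsqi : ∀ j v, Integrable (fun x => (fderiv ℝ (ψ j) x v) ^ 2) := fun j v => by
    have h1 : HasCompactSupport (fun x => fderiv ℝ (ψ j) x v) := (hψs j).fderiv_apply (𝕜 := ℝ) v
    have h2 : HasCompactSupport (fun x => (fderiv ℝ (ψ j) x v) ^ 2) :=
      h1.mono fun x hx h0 => hx (by simp only [h0]; norm_num)
    have h3 : Continuous (fun x => (fderiv ℝ (ψ j) x v) ^ 2) := (hdc j v).pow 2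
    exact h3.integrable_of_hasCompactSupport h2
  have hφd : ∀ x v, fderiv ℝ (fun x => (k:ℝ)⁻¹ * ∑ j ∈ Finset.range k, ψ j x) x v
      = (k:ℝ)⁻¹ * ∑ j ∈ Finset.range k, fderiv ℝ (ψ j) x v := by
    intro x v
    have hd := fun j => (hψc j).differentiable (by norm_num)
    refine fderiv_line ?_ ?_
    · have : Differentiable ℝ (fun x => (k:ℝ)⁻¹ * ∑ j ∈ Finset.range k, ψ j x) := by fun_prop
      exact this x
    · refine HasDerivAt.const_mul _ (HasDerivAt.fun_sum fun j _ => ?_)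
      simpa using hasDerivAt_line (hd j) x v 0
  refine ⟨fun x => (k:ℝ)⁻¹ * ∑ j ∈ Finset.range k, ψ j x, ?_, ?_, ?_, ?_⟩
  · exact contDiff_const.mul (ContDiff.sum fun j _ => hψc j)
  · refine HasCompactSupport.mul_left ?_
    have : ∀ T : Finset ℕ, HasCompactSupport (fun x => ∑ j ∈ T, ψ j x) := by
      intro T
      induction T using Finset.induction_on with
      | empty => simp only [Finset.sum_empty]; exact HasCompactSupport.zero
      | insert a T ha ih =>
        simp only [Finset.sum_insert ha]
        exact (hψs a).add ih
    exact this _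
  · intro x hx
    have : ∀ j, ψ j x = 1 := by
      intro j
      refine χ.one_of_mem_closedBall ?_
      rw [mem_closedBall_zero_iff] at hx ⊢
      rw [norm_smul, Real.norm_of_nonneg (inv_nonneg.2 (hRp j).le), inv_mul_le_iff₀ (hRp j)]
      have := hR1 j
      show ‖x‖ ≤ R j * 1
      linarith
    simp only [this, Finset.sum_const, Finset.card_range, nsmul_eq_mul, mul_one]
    field_simp
  · have hk2 : ∀ v, ∫ x, (fderiv ℝ (fun x => (k:ℝ)⁻¹ * ∑ j ∈ Finset.range k, ψ j x) x v) ^ 2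
        ≤ (k:ℝ)⁻¹ * ∫ x, (fderiv ℝ χ x v) ^ 2 := by
      intro v
      have e : ∀ x, (fderiv ℝ (fun x => (k:ℝ)⁻¹ * ∑ j ∈ Finset.range k, ψ j x) x v) ^ 2
          = ((k:ℝ)⁻¹) ^ 2 * ∑ j ∈ Finset.range k, (fderiv ℝ (ψ j) x v) ^ 2 := by
        intro x
        rw [hφd, mul_pow]
        congr 1
        rw [sq, Finset.sum_mul_sum]
        refine Finset.sum_congr rfl fun j hj => ?_
        rw [Finset.sum_eq_single j (fun l _ hl => hdisj' j l hl.symm x v) (fun h => absurd hj h), sq]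
      simp only [e]
      rw [integral_const_mul, integral_finsetSum _ (fun j _ => hsqi j v)]
      have h5 : ∑ j ∈ Finset.range k, ∫ x, (fderiv ℝ (ψ j) x v) ^ 2
          ≤ k * ∫ x, (fderiv ℝ χ x v) ^ 2 := by
        refine (Finset.sum_le_sum fun j _ => hint j v).trans ?_
        simp
      calc ((k:ℝ)⁻¹) ^ 2 * ∑ j ∈ Finset.range k, ∫ x, (fderiv ℝ (ψ j) x v) ^ 2
          ≤ ((k:ℝ)⁻¹) ^ 2 * (k * ∫ x, (fderiv ℝ χ x v) ^ 2) := by gcongr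
        _ = _ := by field_simp
    refine (Finset.sum_le_sum fun i _ => hk2 _).trans ?_
    rw [← Finset.mul_sum, ← hC, inv_mul_le_iff₀ hk0]
    rw [div_lt_iff₀ hη] at hk
    exact hk.le

lemma copos_delta {n : ℕ} (hn : 0 < n) (B : Matrix (Fin n) (Fin n) ℝ)
    (hcop : ∀ c : Fin n → ℝ, (∀ i, 0 ≤ c i) → c ≠ 0 → 0 < ∑ i, ∑ j, B i j * c i * c j) :
    ∃ δ > 0, ∀ c : Fin n → ℝ, (∀ i, 0 ≤ c i) → δ * (∑ i, c i) ^ 2 ≤ ∑ i, ∑ j, B i j * c i * c j := by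
  have : Nonempty (Fin n) := ⟨⟨0, hn⟩⟩
  obtain ⟨c0, hc0, hmin⟩ := (isCompact_stdSimplex ℝ (Fin n)).exists_isMinOn
    ⟨Pi.single ⟨0, hn⟩ 1, single_mem_stdSimplex ℝ _⟩
    (f := fun c : Fin n → ℝ => ∑ i, ∑ j, B i j * c i * c j) (by fun_prop)
  refine ⟨_, hcop c0 hc0.1 (fun h => ?_), fun c hc => ?_⟩
  · have := hc0.2
    simp [h] at this
  · set s := ∑ i, c i with hs
    have hs0 : 0 ≤ s := Finset.sum_nonneg fun i _ => hc i
    rcases hs0.lt_or_eq with h | h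
    · have hm := hmin (show (s⁻¹ • c) ∈ stdSimplex ℝ (Fin n) from ⟨fun i => by
        simp only [Pi.smul_apply, smul_eq_mul]; have := hc i; positivity, by
        simp only [Pi.smul_apply, smul_eq_mul, ← Finset.mul_sum, ← hs]; field_simp⟩)
      have e : ∑ i, ∑ j, B i j * (s⁻¹ • c) i * (s⁻¹ • c) j
          = (s ^ 2)⁻¹ * ∑ i, ∑ j, B i j * c i * c j := by
        simp only [Finset.mul_sum, Pi.smul_apply, smul_eq_mul]
        refine Finset.sum_congr rfl fun i _ => Finset.sum_congr rfl fun j _ => ?_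
        field_simp
      have hm' : ∑ i, ∑ j, B i j * c0 i * c0 j ≤ (s ^ 2)⁻¹ * ∑ i, ∑ j, B i j * c i * c j := by
        rw [← e]; exact hm
      rw [inv_mul_eq_div, le_div_iff₀ (by positivity)] at hm'
      exact hm'
    · have hz : ∀ i, c i = 0 := by
        intro i
        have := (Finset.sum_eq_zero_iff_of_nonneg (fun i _ => hc i)).1 h.symm i (Finset.mem_univ i)
        exact this
      simp [← h, hz]

theorem nonexistence {N n : ℕ} (hN : N ≤ 2) (hn : 0 < n) (B : Matrix (Fin n) (Fin n) ℝ)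
    (hcop : ∀ c : Fin n → ℝ, (∀ i, 0 ≤ c i) → c ≠ 0 → 0 < ∑ i, ∑ j, B i j * c i * c j)
    (u : Fin n → (Fin N → ℝ) → ℝ) (hu : ∀ i, ContDiff ℝ 2 (u i)) (h0 : ∀ i x, 0 ≤ u i x)
    (heq : ∀ i x, -laplacian (u i) x = ∑ j, B i j * (u j x) ^ 2 * u i x) (i0 : Fin n)
    (hi0 : u i0 ≠ 0) : False := by
  obtain ⟨δ, hδ, hδ2⟩ := copos_delta hn B hcop
  have hc := fun i => (hu i).continuous
  have hVc : ∀ i, Continuous (fun x => ∑ j, B i j * (u j x) ^ 2) := fun i => by fun_prop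
  have heq' : ∀ i x, -laplacian (u i) x = (∑ j, B i j * (u j x) ^ 2) * u i x := fun i x => by
    rw [heq, Finset.sum_mul]
  have hdich : ∀ i, (∀ x, u i x = 0) ∨ ∀ x, 0 < u i x := by
    intro i
    by_cases h : ∃ y, 0 < u i y
    · obtain ⟨y, hy⟩ := h
      exact Or.inr (strong_max (hu i) (h0 i) (hVc i) (heq' i) y hy)
    · push Not at h
      exact Or.inl fun x => le_antisymm (h x) (h0 i x)
  have hpos0 : ∀ x, 0 < u i0 x := by
    rcases hdich i0 with h | h
    · exact absurd (funext h) hi0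
    · exact h
  set κ : ℝ := ∫ x in Metric.closedBall (0 : Fin N → ℝ) 1, u i0 x ^ 2 with hκ
  have hκpos : 0 < κ := by
    rw [hκ, setIntegral_pos_iff_support_of_nonneg_ae]
    · have : Function.support (fun x => u i0 x ^ 2) = Set.univ := by
        ext x; simp [(hpos0 x).ne']
      rw [this, Set.univ_inter]
      exact Metric.measure_closedBall_pos volume _ one_pos
    · exact Eventually.of_forall fun x => sq_nonneg _
    · exact ((hc i0).pow 2).continuousOn.integrableOn_compact (isCompact_closedBall _ _)
  obtain ⟨φ, hφ, hφs, hφ1, hφD⟩ := cutoff hN (δ * κ / 2) (by positivity)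
  set D := ∑ i : Fin N, ∫ x, (fderiv ℝ φ x (Pi.single i 1)) ^ 2
  have hφ2s : HasCompactSupport (fun x => φ x ^ 2) := hφs.comp_left (g := fun t : ℝ => t ^ 2) (by simp)
  have hint : ∀ j, Integrable (fun x => φ x ^ 2 * u j x ^ 2) := fun j =>
    ((hφ.continuous.pow 2).mul ((hc j).pow 2)).integrable_of_hasCompactSupport hφ2s.mul_right
  set c : Fin n → ℝ := fun j => ∫ x, φ x ^ 2 * u j x ^ 2 with hcd
  have hcn : ∀ j, 0 ≤ c j := fun j => integral_nonneg fun x => by positivity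
  have hκc : κ ≤ c i0 := by
    rw [hκ, hcd]
    have e : ∫ x in Metric.closedBall (0 : Fin N → ℝ) 1, u i0 x ^ 2
        = ∫ x in Metric.closedBall (0 : Fin N → ℝ) 1, φ x ^ 2 * u i0 x ^ 2 := by
      refine setIntegral_congr_fun Metric.isClosed_closedBall.measurableSet fun x hx => ?_
      simp [hφ1 x hx]
    rw [e]
    exact setIntegral_le_integral (hint i0) (Eventually.of_forall fun x => by simp only [Pi.zero_apply]; positivity)
  have hrow : ∀ i, c i * ∑ j, B i j * c j ≤ c i * D := by
    intro i
    rcases hdich i with h | h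
    · have : c i = 0 := by simp [hcd, h]
      simp [this]
    · refine mul_le_mul_of_nonneg_left ?_ (hcn i)
      have := log_test_sum (hu i) h (heq' i) hφ hφs
      refine le_of_eq_of_le ?_ this
      simp only [hcd, ← integral_const_mul]
      rw [← integral_finsetSum _ (fun j _ => (hint j).const_mul _)]
      congr 1; funext x
      rw [Finset.mul_sum]
      refine Finset.sum_congr rfl fun j _ => ?_
      ring
  have hq : ∑ i, ∑ j, B i j * c i * c j ≤ (∑ i, c i) * D := by
    rw [Finset.sum_mul]
    refine Finset.sum_le_sum fun i _ => ?_
    refine le_of_eq_of_le ?_ (hrow i)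
    rw [Finset.mul_sum]
    refine Finset.sum_congr rfl fun j _ => ?_
    ring
  have hs : κ ≤ ∑ i, c i := hκc.trans (Finset.single_le_sum (fun i _ => hcn i) (Finset.mem_univ i0))
  have h1 := (hδ2 c hcn).trans hq
  set s := ∑ i, c i
  have hsp : 0 < s := hκpos.trans_le hs
  have h2 : δ * s ≤ D := by
    have : s * (δ * s) ≤ s * D := by linarith [show s * (δ * s) = δ * s ^ 2 by ring]
    exact le_of_mul_le_mul_left this hsp
  have h3 : δ * κ ≤ δ * s := by gcongr
  have h4 := mul_pos hδ hκpos
  linarith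
end liou

end part9

theorem stmt_6 (N n : ℕ) (hN1 : 1 ≤ N) (hN : N ≤ 2) (hn : 2 ≤ n)
    (B : Matrix (Fin n) (Fin n) ℝ) (hsym : B.IsSymm)
    (hdiag : ∀ i, 0 ≤ B i i) :
    (∃ u : Fin n → (Fin N → ℝ) → ℝ,
      (∀ i, ContDiff ℝ 2 (u i)) ∧
      (∀ i x, 0 ≤ u i x) ∧
      (∀ i x, -laplacian (u i) x = ∑ j, B i j * (u j x) ^ 2 * u i x) ∧
      (∃ i, u i ≠ 0)) ↔
    ¬ (∀ c : Fin n → ℝ, (∀ i, 0 ≤ c i) → c ≠ 0 → 0 < ∑ i, ∑ j, B i j * c i * c j) := by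
  constructor
  · rintro ⟨u, hu, h0, heq, i, hi⟩ hcop
    exact nonexistence hN (by omega) B hcop u hu h0 heq i hi
  · exact existence hN1 B hsym hdiag
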